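/- arXiv:1305.3850 — 4 statements merged into one kernel-verified Lean document; each statement's English description precedes it below -/
import Mathlib

section
/- Let q = q_{ℵ₀}. Then Σ_q((1+q³)/(q⁴−1)) = {(1001)^∞} ∪ {(1001)^k 0111(10)^∞ : k ≥ 0} ∪ {(1001)^k 101000(01)^∞ : k ≥ 0}, and Σ_q((q+q²)/(q⁴−1)) = {(0110)^∞} ∪ {(0110)^k 1000(01)^∞ : k ≥ 0} ∪ {(0110)^k 010111(10)^∞ : k ≥ 0}. -/
noncomputable section

open Set

/-- The map `T_{q,i}(x) = q*x - i` for a binary digit `i`. -/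
def Tmap (q : ℝ) (i : Fin 2) (x : ℝ) : ℝ := q * x - ((i : ℕ) : ℝ)

/-- The value `((ε_i)_{i=1}^∞)_q = ∑_{i=1}^∞ ε_i q^{-i}` of a binary sequence in base `q`
(the sequence is 0-indexed, so digit `ε i` has weight `q^{-(i+1)}`). -/
def seqVal (q : ℝ) (ε : ℕ → Fin 2) : ℝ := ∑' i : ℕ, ((ε i : ℕ) : ℝ) / q ^ (i + 1)

/-- `Σ_q(x)`: the set of `q`-expansions of `x`. -/
def SigmaSet (q x : ℝ) : Set (ℕ → Fin 2) := {ε | x = seqVal q ε}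

/-- The interval `I_q = [0, 1/(q-1)]`. -/
def Iq (q : ℝ) : Set ℝ := Icc 0 (1 / (q - 1))

/-- The switch region `S_q = [1/q, 1/(q(q-1))]`. -/
def Sq (q : ℝ) : Set ℝ := Icc (1 / q) (1 / (q * (q - 1)))

/-- The interval `J_q = [(q+q²)/(q⁴-1), (1+q³)/(q⁴-1)]`. -/
def Jq (q : ℝ) : Set ℝ := Icc ((q + q ^ 2) / (q ^ 4 - 1)) ((1 + q ^ 3) / (q ^ 4 - 1))

/-- Apply the first `n` maps of a sequence of maps to `x`:
`applySeq a n x = (a_{n-1} ∘ ⋯ ∘ a_0)(x)`. -/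
def applySeq (a : ℕ → ℝ → ℝ) (n : ℕ) (x : ℝ) : ℝ := (List.range n).foldl (fun y k => a k y) x

/-- `Ω_q(x)`: the set of sequences of maps, each equal to `T_{q,0}` or `T_{q,1}`,
all of whose partial compositions applied to `x` stay in `I_q`. -/
def OmegaSet (q x : ℝ) : Set (ℕ → ℝ → ℝ) :=
  {a | (∀ n, a n = Tmap q 0 ∨ a n = Tmap q 1) ∧ ∀ n : ℕ, applySeq a (n + 1) x ∈ Iq q}

/-- Apply a finite word of digits to `x` (first letter applied first):
for `a = [a₁, …, aₙ]`, `wordMap q a x = (T_{q,aₙ} ∘ ⋯ ∘ T_{q,a₁})(x)`. -/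
def wordMap (q : ℝ) (a : List (Fin 2)) (x : ℝ) : ℝ := a.foldl (fun y i => Tmap q i y) x

/-- A branching sequence for `x`: a finite word whose partial compositions applied to `x`
stay in `I_q`, and whose full composition maps `x` into the switch region `S_q`. -/
def IsBranching (q x : ℝ) (a : List (Fin 2)) : Prop :=
  (∀ k, k ≤ a.length → wordMap q (a.take k) x ∈ Iq q) ∧ wordMap q a x ∈ Sq q

/-- `x` is a `q` null infinite point: `x ∈ (0,1/(q-1))`, `Ω_q(x)` is infinite, and for every
branching sequence `a` for `x` there is a digit `i` with `Ω_q(T_{q,i}(a(x)))` finite. -/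
def NullInfinite (q x : ℝ) : Prop :=
  x ∈ Ioo 0 (1 / (q - 1)) ∧ (OmegaSet q x).Infinite ∧
    ∀ a : List (Fin 2), IsBranching q x a →
      ∃ i : Fin 2, (OmegaSet q (Tmap q i (wordMap q a x))).Finite

/-- `U_q`: points of `I_q` with exactly one `q`-expansion. -/
def UniqSet (q : ℝ) : Set ℝ := {x | x ∈ Iq q ∧ ∃! ε : ℕ → Fin 2, ε ∈ SigmaSet q x}

/-- `B_{ℵ₀}`: bases `q ∈ (1,2)` for which some `x ∈ (0,1/(q-1))` has exactly countably
infinitely many `q`-expansions. -/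
def BAleph0 : Set ℝ :=
  {q | q ∈ Ioo (1 : ℝ) 2 ∧ ∃ x ∈ Ioo (0 : ℝ) (1 / (q - 1)),
    Cardinal.mk ↥(SigmaSet q x) = Cardinal.aleph0}

/-- The eventually periodic binary sequence `u w^∞`: the finite word `u` followed by
infinitely many repetitions of the finite word `w`. -/
def uwInf (u w : List (Fin 2)) : ℕ → Fin 2 := fun i =>
  if i < u.length then u.getD i 0 else w.getD ((i - u.length) % w.length) 0

/-- Prepend a finite word to a sequence. -/
def prepend (u : List (Fin 2)) (ε : ℕ → Fin 2) : ℕ → Fin 2 := fun i =>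
  if i < u.length then u.getD i 0 else ε (i - u.length)

theorem prepend_nil (ε : ℕ → Fin 2) : prepend [] ε = ε := by
  funext i; simp [prepend]

theorem prepend_append (u v : List (Fin 2)) (ε : ℕ → Fin 2) :
    prepend (u ++ v) ε = prepend u (prepend v ε) := by
  funext i
  simp only [prepend, List.length_append, List.getD_eq_getElem?_getD, List.getElem?_append]
  split_ifs <;> first | rfl | omega | (congr 1; omega)

theorem prepend_cons (d : Fin 2) (u : List (Fin 2)) (ε : ℕ → Fin 2) :
    prepend (d :: u) ε = prepend [d] (prepend u ε) :=
  prepend_append [d] u ε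

theorem eq_prepend_tail (ε : ℕ → Fin 2) : ε = prepend [ε 0] (fun n => ε (n + 1)) := by
  funext i
  cases i <;> simp [prepend]

theorem uwInf_eq_prepend (u w : List (Fin 2)) : uwInf u w = prepend u (uwInf [] w) := by
  funext i
  simp [uwInf, prepend]

theorem uwInf_nil_eq_prepend (w : List (Fin 2)) : uwInf [] w = prepend w (uwInf [] w) := by
  funext i
  simp only [uwInf, prepend, List.length_nil, Nat.not_lt_zero, if_false, Nat.sub_zero]
  split_ifs with h
  · rw [Nat.mod_eq_of_lt h]
  · rw [Nat.mod_eq_sub_mod (not_lt.mp h)]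

theorem summable_expansion {q : ℝ} (hq : 1 < q) (ε : ℕ → Fin 2) :
    Summable fun i : ℕ => ((ε i : ℕ) : ℝ) / q ^ (i + 1) := by
  have hg : Summable fun i : ℕ => (q⁻¹) ^ i :=
    summable_geometric_of_lt_one (by positivity) (inv_lt_one_of_one_lt₀ hq)
  refine Summable.of_nonneg_of_le (fun i => by positivity) (fun i => ?_) hg
  have h1 : ((ε i : ℕ) : ℝ) ≤ 1 := by exact_mod_cast Nat.le_of_lt_succ (ε i).isLt
  rw [inv_pow, ← one_div]
  exact div_le_div₀ zero_le_one h1 (by positivity) (pow_le_pow_right₀ hq.le (Nat.le_succ i))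

theorem seqVal_prepend_singleton {q : ℝ} (hq : 1 < q) (d : Fin 2) (ε : ℕ → Fin 2) :
    q * seqVal q (prepend [d] ε) = (d : ℕ) + seqVal q ε := by
  have hq0 : q ≠ 0 := by positivity
  unfold seqVal
  rw [(summable_expansion hq _).tsum_eq_zero_add, mul_add, ← tsum_mul_left]
  congr 1
  · simp [prepend]
    field_simp
  · refine tsum_congr fun i => ?_
    simp only [prepend, List.length_singleton, Nat.not_lt.mpr (Nat.le_add_left 1 i), if_false,
      Nat.add_sub_cancel]
    field_simp
    ring

theorem seqVal_nonneg {q : ℝ} (hq : 1 < q) (ε : ℕ → Fin 2) : 0 ≤ seqVal q ε :=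
  tsum_nonneg fun i => by positivity

theorem sub_one_mul_seqVal_le_one {q : ℝ} (hq : 1 < q) (ε : ℕ → Fin 2) :
    (q - 1) * seqVal q ε ≤ 1 := by
  have hone := seqVal_prepend_singleton hq 1 (fun _ => 1)
  have hconst : prepend [1] (fun _ => 1) = fun _ => (1 : Fin 2) :=
    (eq_prepend_tail fun _ => 1).symm
  rw [hconst] at hone
  have hle : seqVal q ε ≤ seqVal q fun _ => 1 := by
    refine (summable_expansion hq _).tsum_le_tsum (fun i => ?_) (summable_expansion hq _)
    have h1 : ((ε i : ℕ) : ℝ) ≤ ((1 : Fin 2) : ℕ) := by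
      exact_mod_cast Nat.le_of_lt_succ (ε i).isLt
    gcongr
  have h : (q - 1) * (seqVal q fun _ => 1) = 1 := by
    simp only [Fin.val_one, Nat.cast_one] at hone
    linarith
  nlinarith

theorem prepend_mem_SigmaSet {q : ℝ} (hq : 1 < q) (u : List (Fin 2)) (ε : ℕ → Fin 2) (x : ℝ) :
    prepend u ε ∈ SigmaSet q x ↔ ε ∈ SigmaSet q (wordMap q u x) := by
  induction u generalizing x with
  | nil => simp [prepend_nil, wordMap]
  | cons d u ih =>
    have hq0 : q ≠ 0 := by positivity
    rw [prepend_cons, wordMap, List.foldl_cons, ← wordMap, ← ih]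
    simp only [SigmaSet, mem_ofPred_eq, Tmap]
    rw [sub_eq_iff_eq_add', ← seqVal_prepend_singleton hq, mul_right_inj' hq0]

/-- At every stage of applying the word to `x`, the other digit leads out of `I_q`. -/
def ForcedWord (q : ℝ) : List (Fin 2) → ℝ → Prop
  | [], _ => True
  | d :: u, x => (if d = 0 then q * x < 1 else 1 < (q - 1) * (q * x)) ∧
      ForcedWord q u (Tmap q d x)

theorem ForcedWord.exists_eq_prepend {q : ℝ} (hq : 1 < q) {u : List (Fin 2)} {x : ℝ}
    (hu : ForcedWord q u x) {ε : ℕ → Fin 2} (hε : ε ∈ SigmaSet q x) :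
    ∃ δ ∈ SigmaSet q (wordMap q u x), ε = prepend u δ := by
  induction u generalizing x ε with
  | nil => exact ⟨ε, hε, (prepend_nil ε).symm⟩
  | cons d u ih =>
    obtain ⟨hd, hu⟩ := hu
    have htail := eq_prepend_tail ε
    have hmem := hε
    rw [htail, prepend_mem_SigmaSet hq] at hmem
    simp only [wordMap, List.foldl_cons, List.foldl_nil] at hmem
    have hdigit : ε 0 = d := by
      have h0 := seqVal_nonneg hq fun n => ε (n + 1)
      have h1 := sub_one_mul_seqVal_le_one hq fun n => ε (n + 1)
      simp only [SigmaSet, mem_ofPred_eq] at hmem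
      rw [← hmem] at h0 h1
      generalize ε 0 = e at h0 h1
      fin_cases e <;> fin_cases d <;> simp [Tmap] at h0 h1 hd ⊢ <;> linarith
    rw [hdigit] at hmem htail
    obtain ⟨δ, hδ, h⟩ := ih hu hmem
    exact ⟨δ, hδ, by rw [htail, h, ← prepend_cons]⟩

theorem mem_SigmaSet_branch {q : ℝ} (hq : 1 < q) {x : ℝ} {ε : ℕ → Fin 2}
    (hε : ε ∈ SigmaSet q x) {u v : List (Fin 2)} (hu : ForcedWord q u (Tmap q 0 x))
    (hv : ForcedWord q v (Tmap q 1 x)) :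
    (∃ δ ∈ SigmaSet q (wordMap q (0 :: u) x), ε = prepend (0 :: u) δ) ∨
      ∃ δ ∈ SigmaSet q (wordMap q (1 :: v) x), ε = prepend (1 :: v) δ := by
  have htail := eq_prepend_tail ε
  rw [htail, prepend_mem_SigmaSet hq] at hε
  generalize ε 0 = e at hε htail
  fin_cases e
  · obtain ⟨δ, hδ, h⟩ := hu.exists_eq_prepend hq hε
    exact Or.inl ⟨δ, hδ, by rw [htail, h, prepend_cons 0 u]; rfl⟩
  · obtain ⟨δ, hδ, h⟩ := hv.exists_eq_prepend hq hε
    exact Or.inr ⟨δ, hδ, by rw [htail, h, prepend_cons 1 v]; rfl⟩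

theorem wordMap_sub (q : ℝ) (u : List (Fin 2)) (x y : ℝ) :
    wordMap q u x - wordMap q u y = q ^ u.length * (x - y) := by
  induction u generalizing x y with
  | nil => simp [wordMap]
  | cons d u ih =>
    simp only [wordMap, List.foldl_cons] at ih ⊢
    rw [ih, Tmap, Tmap, List.length_cons]
    ring

theorem uwInf_nil_mem_SigmaSet {q : ℝ} (hq : 1 < q) {w : List (Fin 2)} (hw : w ≠ []) {x : ℝ}
    (hx : wordMap q w x = x) : uwInf [] w ∈ SigmaSet q x := by
  have h : uwInf [] w ∈ SigmaSet q (seqVal q (uwInf [] w)) := rfl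
  rw [uwInf_nil_eq_prepend w, prepend_mem_SigmaSet hq, ← uwInf_nil_eq_prepend] at h
  have hsub := wordMap_sub q w x (seqVal q (uwInf [] w))
  rw [hx, h] at hsub
  have hpow : 1 < q ^ w.length := one_lt_pow₀ hq (by simpa using hw)
  have : (q ^ w.length - 1) * (x - seqVal q (uwInf [] w)) = 0 := by linarith
  rcases mul_eq_zero.mp this with h | h
  · linarith
  · exact sub_eq_zero.mp h

theorem eq_uwInf_nil_or_exists_of_step {w : List (Fin 2)} (hw : w ≠ []) {S L : Set (ℕ → Fin 2)}
    (hstep : ∀ ε ∈ S, (∃ δ ∈ S, ε = prepend w δ) ∨ ε ∈ L) {ε : ℕ → Fin 2} (hε : ε ∈ S) :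
    ε = uwInf [] w ∨ ∃ k : ℕ, ∃ δ ∈ L, ε = prepend (List.replicate k w).flatten δ := by
  refine or_iff_not_imp_right.mpr fun hL => ?_
  have hlen : 0 < w.length := List.length_pos_iff.mpr hw
  have key : ∀ k : ℕ, ∃ δ ∈ S, ε = prepend (List.replicate k w).flatten δ := by
    intro k
    induction k with
    | zero => exact ⟨ε, hε, by simp [prepend_nil]⟩
    | succ k ih =>
      obtain ⟨δ, hδ, h⟩ := ih
      rcases hstep δ hδ with ⟨δ', hδ', h'⟩ | h'
      · exact ⟨δ', hδ', by
          rw [h, h', List.replicate_succ', List.flatten_append, List.flatten_singleton,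
            prepend_append]⟩
      · exact absurd ⟨k, δ, h', h⟩ hL
  have hper : ∀ k : ℕ, uwInf [] w = prepend (List.replicate k w).flatten (uwInf [] w) := by
    intro k
    induction k with
    | zero => simp [prepend_nil]
    | succ k ih =>
      rw [List.replicate_succ, List.flatten_cons, prepend_append, ← ih, ← uwInf_nil_eq_prepend]
  funext n
  obtain ⟨δ, -, h⟩ := key (n + 1)
  have hn : n < (List.replicate (n + 1) w).flatten.length := by
    simp only [List.length_flatten, List.map_replicate, List.sum_replicate, smul_eq_mul]
    nlinarith
  rw [h, hper (n + 1)]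
  simp only [prepend, hn, if_true]

theorem prepend_replicate_mem_SigmaSet {q : ℝ} (hq : 1 < q) {w : List (Fin 2)} {x : ℝ}
    (hx : wordMap q w x = x) {ε : ℕ → Fin 2} (hε : ε ∈ SigmaSet q x) (k : ℕ) :
    prepend (List.replicate k w).flatten ε ∈ SigmaSet q x := by
  induction k with
  | zero => simpa [prepend_nil] using hε
  | succ k ih =>
    rw [List.replicate_succ, List.flatten_cons, prepend_append, prepend_mem_SigmaSet hq, hx]
    exact ih

theorem SigmaSet_eq_singleton_of_forcedWord {q : ℝ} (hq : 1 < q) {w : List (Fin 2)} (hw : w ≠ [])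
    {x : ℝ} (hx : wordMap q w x = x) (hforced : ForcedWord q w x) :
    SigmaSet q x = {uwInf [] w} := by
  refine Subset.antisymm (fun ε hε => ?_)
    (singleton_subset_iff.mpr (uwInf_nil_mem_SigmaSet hq hw hx))
  have := eq_uwInf_nil_or_exists_of_step (L := ∅) hw (fun ε hε => Or.inl (by
    simpa only [hx] using hforced.exists_eq_prepend hq hε)) hε
  simpa using this

/-- Expansions of a point fixed by the word `w`, each of which either begins with `w` and
returns to that point, or is one of two exceptional sequences. -/
theorem SigmaSet_eq_of_step {q : ℝ} (hq : 1 < q) {w u v s t : List (Fin 2)} (hw : w ≠ [])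
    {x : ℝ} (hx : wordMap q w x = x) (hu : uwInf u s ∈ SigmaSet q x)
    (hv : uwInf v t ∈ SigmaSet q x)
    (hstep : ∀ ε ∈ SigmaSet q x,
      (∃ δ ∈ SigmaSet q x, ε = prepend w δ) ∨ ε = uwInf u s ∨ ε = uwInf v t) :
    SigmaSet q x = {uwInf [] w} ∪
      {ε | ∃ k : ℕ, ε = uwInf ((List.replicate k w).flatten ++ u) s} ∪
      {ε | ∃ k : ℕ, ε = uwInf ((List.replicate k w).flatten ++ v) t} := by
  have happ : ∀ (k : ℕ) (a b : List (Fin 2)), uwInf ((List.replicate k w).flatten ++ a) b =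
      prepend (List.replicate k w).flatten (uwInf a b) := fun k a b => by
    rw [uwInf_eq_prepend, prepend_append, ← uwInf_eq_prepend]
  ext ε
  simp only [happ, mem_union, mem_singleton_iff, mem_ofPred_eq]
  constructor
  · intro hε
    rcases eq_uwInf_nil_or_exists_of_step (L := {uwInf u s, uwInf v t}) hw hstep hε with
      h | ⟨k, δ, rfl | rfl, h⟩
    exacts [Or.inl (Or.inl h), Or.inl (Or.inr ⟨k, h⟩), Or.inr ⟨k, h⟩]
  · rintro ((rfl | ⟨k, rfl⟩) | ⟨k, rfl⟩)
    exacts [uwInf_nil_mem_SigmaSet hq hw hx, prepend_replicate_mem_SigmaSet hq hx hu k,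
      prepend_replicate_mem_SigmaSet hq hx hv k]

/-- Two points exchanged by the words `w₁` and `w₂`, where each expansion of either point begins
with the exchanging word or is one exceptional sequence. -/
theorem SigmaSet_eq_of_alternation {q : ℝ} (hq : 1 < q) {d e : Fin 2} {w₁ w₂ u v s t : List (Fin 2)}
    {x y : ℝ} (hxy : wordMap q (d :: w₁) x = y) (hyx : wordMap q (e :: w₂) y = x)
    (hu : uwInf u s ∈ SigmaSet q x) (hv : uwInf v t ∈ SigmaSet q y)
    (hx : ∀ ε ∈ SigmaSet q x,
      (∃ δ ∈ SigmaSet q y, ε = prepend (d :: w₁) δ) ∨ ε = uwInf u s)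
    (hy : ∀ ε ∈ SigmaSet q y,
      (∃ δ ∈ SigmaSet q x, ε = prepend (e :: w₂) δ) ∨ ε = uwInf v t) :
    SigmaSet q x = {uwInf [] (d :: w₁ ++ e :: w₂)} ∪
      {ε | ∃ k : ℕ, ε = uwInf ((List.replicate k (d :: w₁ ++ e :: w₂)).flatten ++ u) s} ∪
      {ε | ∃ k : ℕ, ε = uwInf ((List.replicate k (d :: w₁ ++ e :: w₂)).flatten ++
        (d :: w₁ ++ v)) t} := by
  have happ : uwInf (d :: w₁ ++ v) t = prepend (d :: w₁) (uwInf v t) := by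
    rw [uwInf_eq_prepend, prepend_append, ← uwInf_eq_prepend]
  refine SigmaSet_eq_of_step hq (by simp) ?_ hu ?_ fun ε hε => ?_
  · rw [wordMap, List.foldl_append, ← wordMap, ← wordMap, hxy, hyx]
  · rwa [happ, prepend_mem_SigmaSet hq, hxy]
  · rcases hx ε hε with ⟨δ, hδ, rfl⟩ | h
    · rcases hy δ hδ with ⟨δ', hδ', rfl⟩ | rfl
      · exact Or.inl ⟨δ', hδ', (prepend_append _ _ _).symm⟩
      · exact Or.inr (Or.inr happ.symm)
    · exact Or.inr (Or.inl h)

theorem qAleph0_bounds {q : ℝ} (hq1 : 1 < q)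
    (hq : q ^ 6 = q ^ 4 + q ^ 3 + 2 * q ^ 2 + q + 1) : 1.6454 < q ∧ q < 1.6455 := by
  have hq0 : 0 < q := by linarith
  constructor
  · by_contra! h
    have hpow : ∀ k : ℕ, q ^ k ≤ 1.6454 ^ k := fun k => pow_le_pow_left₀ hq0.le h k
    have hmul : ∀ k l : ℕ, q ^ (k + l) ≤ q ^ k * 1.6454 ^ l := fun k l => by
      rw [pow_add]
      exact mul_le_mul_of_nonneg_left (hpow l) (by positivity)
    have h0 := hmul 0 6
    have h1 := hmul 1 5
    have h2 := hmul 2 4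
    have h3 := hmul 3 3
    have h4 := hmul 4 2
    norm_num at h0 h1 h2 h3 h4
    have : 0 < q ^ 6 := by positivity
    linarith
  · by_contra! h
    obtain ⟨t, ht, rfl⟩ : ∃ t : ℝ, 0 ≤ t ∧ q = 1.6455 + t := ⟨q - 1.6455, by linarith, by ring⟩
    ring_nf at hq
    have : 0 ≤ t ^ 2 := by positivity
    have : 0 ≤ t ^ 3 := by positivity
    have : 0 ≤ t ^ 4 := by positivity
    have : 0 ≤ t ^ 5 := by positivity
    have : 0 ≤ t ^ 6 := by positivity
    linarith

theorem mul_between {q x l u l' u' : ℝ} (hq : 1.6454 < q ∧ q < 1.6455) (hx : l < x ∧ x < u)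
    (hl : 0 ≤ l) (hl' : l' ≤ 1.6454 * l) (hu' : 1.6455 * u ≤ u') : l' < q * x ∧ q * x < u' := by
  obtain ⟨hq1, hq2⟩ := hq
  obtain ⟨hx1, hx2⟩ := hx
  constructor <;> nlinarith

/-- The explicit description of the `q_{ℵ₀}`-expansions of `(1+q³)/(q⁴−1)`
and `(q+q²)/(q⁴−1)`. -/
theorem qAleph0_expansion_sets
    (qA : ℝ) (hqA1 : qA ∈ Set.Ioo (1 : ℝ) 2)
    (hqA2 : qA ^ 6 = qA ^ 4 + qA ^ 3 + 2 * qA ^ 2 + qA + 1) :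
    SigmaSet qA ((1 + qA ^ 3) / (qA ^ 4 - 1)) =
      {uwInf [] [1, 0, 0, 1]} ∪
      {ε | ∃ k : ℕ, ε = uwInf ((List.replicate k ([1, 0, 0, 1] : List (Fin 2))).flatten
        ++ [0, 1, 1, 1]) [1, 0]} ∪
      {ε | ∃ k : ℕ, ε = uwInf ((List.replicate k ([1, 0, 0, 1] : List (Fin 2))).flatten
        ++ [1, 0, 1, 0, 0, 0]) [0, 1]} ∧
    SigmaSet qA ((qA + qA ^ 2) / (qA ^ 4 - 1)) =
      {uwInf [] [0, 1, 1, 0]} ∪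
      {ε | ∃ k : ℕ, ε = uwInf ((List.replicate k ([0, 1, 1, 0] : List (Fin 2))).flatten
        ++ [1, 0, 0, 0]) [0, 1]} ∪
      {ε | ∃ k : ℕ, ε = uwInf ((List.replicate k ([0, 1, 1, 0] : List (Fin 2))).flatten
        ++ [0, 1, 0, 1, 1, 1]) [1, 0]} := by

  have hq1 : 1 < qA := hqA1.1
  have hb := qAleph0_bounds hq1 hqA2
  have hdr : ∀ y : ℝ, 1.5499 < y → 1 < (qA - 1) * y := fun y hy => by nlinarith [hb.1]
  have b2 := mul_between (l' := 2.7073) (u' := 2.7077) hb hb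
    (by norm_num) (by norm_num) (by norm_num)
  have b3 := mul_between (l' := 4.4545) (u' := 4.4557) hb b2
    (by norm_num) (by norm_num) (by norm_num)
  have b4 := mul_between (l' := 7.3294) (u' := 7.332) hb b3
    (by norm_num) (by norm_num) (by norm_num)
  have e2 : qA ^ 2 = qA * qA := by ring
  have e3 : qA ^ 3 = qA * (qA * qA) := by ring
  have e4 : qA ^ 4 = qA * (qA * (qA * qA)) := by ring
  have hd2 : 0 < qA ^ 2 - 1 := by rw [e2]; linarith
  have hd4 : 0 < qA ^ 4 - 1 := by rw [e4]; linarith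
  have hfac : qA ^ 4 - 1 = (qA ^ 2 - 1) * (qA ^ 2 + 1) := by ring
  have hC : 0.963 < qA / (qA ^ 2 - 1) ∧ qA / (qA ^ 2 - 1) < 0.965 := by
    rw [lt_div_iff₀ hd2, div_lt_iff₀ hd2, e2]
    constructor <;> linarith
  have hD : 0.585 < 1 / (qA ^ 2 - 1) ∧ 1 / (qA ^ 2 - 1) < 0.587 := by
    rw [lt_div_iff₀ hd2, div_lt_iff₀ hd2, e2]
    constructor <;> linarith
  have hA : 0.861 < (1 + qA ^ 3) / (qA ^ 4 - 1) ∧ (1 + qA ^ 3) / (qA ^ 4 - 1) < 0.863 := by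
    rw [lt_div_iff₀ hd4, div_lt_iff₀ hd4, e3, e4]
    constructor <;> linarith
  have hB : 0.687 < (qA + qA ^ 2) / (qA ^ 4 - 1) ∧ (qA + qA ^ 2) / (qA ^ 4 - 1) < 0.689 := by
    rw [lt_div_iff₀ hd4, div_lt_iff₀ hd4, e2, e4]
    constructor <;> linarith
  have hA10 : wordMap qA [1, 0] ((1 + qA ^ 3) / (qA ^ 4 - 1)) =
      (qA + qA ^ 2) / (qA ^ 4 - 1) := by
    simp [wordMap, Tmap]
    field_simp
    ring
  have hB01 : wordMap qA [0, 1] ((qA + qA ^ 2) / (qA ^ 4 - 1)) =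
      (1 + qA ^ 3) / (qA ^ 4 - 1) := by
    simp [wordMap, Tmap]
    field_simp
    ring
  have hA0111 : wordMap qA [0, 1, 1, 1] ((1 + qA ^ 3) / (qA ^ 4 - 1)) =
      qA / (qA ^ 2 - 1) := by
    simp [wordMap, Tmap]
    rw [hfac]
    field_simp
    linear_combination (qA - 1) * hqA2
  have hB1000 : wordMap qA [1, 0, 0, 0] ((qA + qA ^ 2) / (qA ^ 4 - 1)) =
      1 / (qA ^ 2 - 1) := by
    simp [wordMap, Tmap]
    rw [hfac]
    field_simp
    linear_combination -(qA - 1) * hqA2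
  generalize (1 + qA ^ 3) / (qA ^ 4 - 1) = a at *
  generalize (qA + qA ^ 2) / (qA ^ 4 - 1) = b at *
  have hCD : Tmap qA 1 (qA / (qA ^ 2 - 1)) = 1 / (qA ^ 2 - 1) := by
    simp [Tmap]
    field_simp
    ring
  have hDC : Tmap qA 0 (1 / (qA ^ 2 - 1)) = qA / (qA ^ 2 - 1) := by
    simp [Tmap]
    field_simp
  generalize qA / (qA ^ 2 - 1) = c at *
  generalize 1 / (qA ^ 2 - 1) = d at *
  have qa := mul_between (l' := 1.4166) (u' := 1.421) hb hA
    (by norm_num) (by norm_num) (by norm_num)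
  have qb := mul_between (l' := 1.13) (u' := 1.134) hb hB
    (by norm_num) (by norm_num) (by norm_num)
  have qc := mul_between (l' := 1.584) (u' := 1.589) hb hC
    (by norm_num) (by norm_num) (by norm_num)
  have qd := mul_between (l' := 0.962) (u' := 0.966) hb hD
    (by norm_num) (by norm_num) (by norm_num)
  have hforcedC : 1 < (qA - 1) * (qA * c) := hdr _ (by linarith)
  have hSC : SigmaSet qA c = {uwInf [] [1, 0]} :=
    SigmaSet_eq_singleton_of_forcedWord hq1 (by simp) (by simp [wordMap, hCD, hDC])
      (by simpa [ForcedWord, hCD] using ⟨hforcedC, by linarith⟩)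
  have hSD : SigmaSet qA d = {uwInf [] [0, 1]} :=
    SigmaSet_eq_singleton_of_forcedWord hq1 (by simp) (by simp [wordMap, hCD, hDC])
      (by simpa [ForcedWord, hDC] using ⟨by linarith, hforcedC⟩)
  have hFA1 : ForcedWord qA [0] (Tmap qA 1 a) := by
    have h : 0.4166 < qA * a - 1 ∧ qA * a - 1 < 0.421 := by constructor <;> linarith
    have := mul_between (l' := 0.6) (u' := 0.7) hb h (by norm_num) (by norm_num) (by norm_num)
    simp [ForcedWord, Tmap]
    linarith
  have hFB0 : ForcedWord qA [1] (Tmap qA 0 b) := by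
    have := mul_between (l' := 1.85) (u' := 1.87) hb qb (by norm_num) (by norm_num) (by norm_num)
    simp [ForcedWord, Tmap]
    exact hdr _ (by linarith)
  have hFA0 : ForcedWord qA [1, 1, 1] (Tmap qA 0 a) := by
    have h1 := mul_between (l' := 2.33) (u' := 2.339) hb qa
      (by norm_num) (by norm_num) (by norm_num)
    have g1 : 1.33 < qA * (qA * a) - 1 ∧ qA * (qA * a) - 1 < 1.339 := by
      constructor <;> linarith
    have h2 := mul_between (l' := 2.18) (u' := 2.21) hb g1
      (by norm_num) (by norm_num) (by norm_num)
    have g2 : 1.18 < qA * (qA * (qA * a) - 1) - 1 ∧ qA * (qA * (qA * a) - 1) - 1 < 1.21 := by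
      constructor <;> linarith
    have h3 := mul_between (l' := 1.9) (u' := 2) hb g2
      (by norm_num) (by norm_num) (by norm_num)
    simp [ForcedWord, Tmap]
    exact ⟨hdr _ (by linarith), hdr _ (by linarith), hdr _ (by linarith)⟩
  have hFB1 : ForcedWord qA [0, 0, 0] (Tmap qA 1 b) := by
    have g1 : 0.13 < qA * b - 1 ∧ qA * b - 1 < 0.134 := by constructor <;> linarith
    have h1 := mul_between (l' := 0.21) (u' := 0.221) hb g1
      (by norm_num) (by norm_num) (by norm_num)
    have h2 := mul_between (l' := 0.34) (u' := 0.364) hb h1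
      (by norm_num) (by norm_num) (by norm_num)
    have h3 := mul_between (l' := 0.5) (u' := 0.6) hb h2
      (by norm_num) (by norm_num) (by norm_num)
    simp [ForcedWord, Tmap]
    exact ⟨by linarith, by linarith, by linarith⟩
  have hstepA : ∀ ε ∈ SigmaSet qA a,
      (∃ δ ∈ SigmaSet qA b, ε = prepend [1, 0] δ) ∨ ε = uwInf [0, 1, 1, 1] [1, 0] := by
    intro ε hε
    rcases mem_SigmaSet_branch hq1 hε hFA0 hFA1 with ⟨δ, hδ, rfl⟩ | ⟨δ, hδ, rfl⟩
    · rw [hA0111, hSC, mem_singleton_iff] at hδ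
      exact Or.inr (hδ ▸ (uwInf_eq_prepend _ _).symm)
    · rw [hA10] at hδ
      exact Or.inl ⟨δ, hδ, rfl⟩
  have hstepB : ∀ ε ∈ SigmaSet qA b,
      (∃ δ ∈ SigmaSet qA a, ε = prepend [0, 1] δ) ∨ ε = uwInf [1, 0, 0, 0] [0, 1] := by
    intro ε hε
    rcases mem_SigmaSet_branch hq1 hε hFB0 hFB1 with ⟨δ, hδ, rfl⟩ | ⟨δ, hδ, rfl⟩
    · rw [hB01] at hδ
      exact Or.inl ⟨δ, hδ, rfl⟩
    · rw [hB1000, hSD, mem_singleton_iff] at hδ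
      exact Or.inr (hδ ▸ (uwInf_eq_prepend _ _).symm)
  have hmemA : uwInf [0, 1, 1, 1] [1, 0] ∈ SigmaSet qA a := by
    rw [uwInf_eq_prepend, prepend_mem_SigmaSet hq1, hA0111, hSC]
    rfl
  have hmemB : uwInf [1, 0, 0, 0] [0, 1] ∈ SigmaSet qA b := by
    rw [uwInf_eq_prepend, prepend_mem_SigmaSet hq1, hB1000, hSD]
    rfl
  exact ⟨SigmaSet_eq_of_alternation hq1 hA10 hB01 hmemA hmemB hstepA hstepB,
    SigmaSet_eq_of_alternation hq1 hB01 hA10 hmemB hmemA hstepB hstepA⟩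
end
end

section
/- Let q ∈ (1,2) and x ∈ I_q. If Ω_q(x) is uncountable, then there exists a branching sequence a for x such that both Ω_q(T_{q,0}(a(x))) and Ω_q(T_{q,1}(a(x))) are uncountable. -/
noncomputable section

open Set

/-- An uncountable set of sequences over a countable alphabet contains two sequences such that,
just after they first differ, both prefixes have uncountably many continuations in the set. -/
theorem Set.exists_uncountable_prefix_split {α : Type*} {s : Set α} (hs : s.Countable)
    {A : Set (ℕ → α)} (hAs : ∀ a ∈ A, ∀ n, a n ∈ s) (hA : ¬ A.Countable) :
    ∃ a ∈ A, ∃ b ∈ A, ∃ n, (∀ k < n, a k = b k) ∧ a n ≠ b n ∧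
      ¬ {c ∈ A | ∀ k < n + 1, c k = a k}.Countable ∧
      ¬ {c ∈ A | ∀ k < n + 1, c k = b k}.Countable := by
  classical
  have := hs.to_subtype
  set B : Set (ℕ → α) := {a ∈ A | ∃ n, {c ∈ A | ∀ k < n, c k = a k}.Countable}
  have hBc : B.Countable := by
    have hU : (⋃ (n : ℕ) (p : Fin n → s) (_ : {c ∈ A | ∀ k : Fin n, c k = p k}.Countable),
        {c ∈ A | ∀ k : Fin n, c k = p k}).Countable :=
      countable_iUnion fun n => countable_iUnion fun p => countable_iUnion fun h => h
    refine hU.mono ?_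
    rintro a ⟨haA, n, hn⟩
    simp only [mem_iUnion]
    refine ⟨n, fun k => ⟨a k, hAs a haA k⟩, ?_, haA, fun k => rfl⟩
    refine hn.mono ?_
    rintro c ⟨hcA, hc⟩
    exact ⟨hcA, fun k hk => hc ⟨k, hk⟩⟩
  have hnc : ¬ (A \ B).Countable := fun h =>
    hA ((h.union hBc).mono fun a ha => by by_cases haB : a ∈ B <;> simp [ha, haB])
  obtain ⟨a, ha, b, hb, hab⟩ : (A \ B).Nontrivial := by
    rw [← not_subsingleton_iff]
    exact fun h => hnc h.countable
  have hex : ∃ n, a n ≠ b n := Function.ne_iff.1 hab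
  refine ⟨a, ha.1, b, hb.1, Nat.find hex, fun k hk => not_not.1 (Nat.find_min hex hk),
    Nat.find_spec hex, fun h => ha.2 ⟨ha.1, _, h⟩, fun h => hb.2 ⟨hb.1, _, h⟩⟩

theorem applySeq_succ (a : ℕ → ℝ → ℝ) (n : ℕ) (x : ℝ) :
    applySeq a (n + 1) x = a n (applySeq a n x) := by
  simp [applySeq, List.range_succ]

theorem applySeq_congr {a b : ℕ → ℝ → ℝ} {n : ℕ} (h : ∀ k < n, a k = b k) (x : ℝ) :
    applySeq a n x = applySeq b n x := by
  induction n with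
  | zero => rfl
  | succ n ih =>
    rw [applySeq_succ, applySeq_succ, ih fun k hk => h k (by omega), h n (by omega)]

theorem applySeq_shift (a : ℕ → ℝ → ℝ) (n m : ℕ) (x : ℝ) :
    applySeq (fun k => a (n + k)) m (applySeq a n x) = applySeq a (n + m) x := by
  induction m with
  | zero => rfl
  | succ m ih => rw [applySeq_succ, ih, ← add_assoc, applySeq_succ]

theorem wordMap_map_range {q : ℝ} {a : ℕ → ℝ → ℝ} {d : ℕ → Fin 2}
    (h : ∀ n, a n = Tmap q (d n)) (n : ℕ) (x : ℝ) :
    wordMap q ((List.range n).map d) x = applySeq a n x := by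
  simp [wordMap, applySeq, List.foldl_map, h]

theorem applySeq_mem_Iq {q x : ℝ} {a : ℕ → ℝ → ℝ} (hx : x ∈ Iq q) (ha : a ∈ OmegaSet q x)
    (n : ℕ) : applySeq a n x ∈ Iq q := by
  cases n with
  | zero => exact hx
  | succ n => exact ha.2 n

/-- The sequences in `Ω_q(x)` with a given prefix of length `n` are countably many as soon as
`Ω_q` of the image of `x` under that prefix is countable. -/
theorem countable_OmegaSet_prefix {q x : ℝ} {a : ℕ → ℝ → ℝ} {n : ℕ}
    (h : (OmegaSet q (applySeq a n x)).Countable) :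
    {c ∈ OmegaSet q x | ∀ k < n, c k = a k}.Countable := by
  have hmaps : MapsTo (fun (c : ℕ → ℝ → ℝ) k => c (n + k))
      {c ∈ OmegaSet q x | ∀ k < n, c k = a k} (OmegaSet q (applySeq a n x)) := by
    rintro c ⟨hc, hca⟩
    refine ⟨fun k => hc.1 _, fun m => ?_⟩
    rw [← applySeq_congr hca, applySeq_shift]
    exact hc.2 (n + m)
  refine hmaps.countable_of_injOn ?_ h
  rintro c ⟨-, hc⟩ c' ⟨-, hc'⟩ hcc
  funext k
  rcases lt_or_ge k n with hk | hk
  · rw [hc k hk, hc' k hk]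
  · simpa [Nat.add_sub_cancel' hk] using congrFun hcc (k - n)

theorem mem_Sq_of_Tmap_mem_Iq {q y : ℝ} (hq : 1 < q) (h0 : Tmap q 0 y ∈ Iq q)
    (h1 : Tmap q 1 y ∈ Iq q) : y ∈ Sq q := by
  have hq0 : 0 < q := by linarith
  have h0' : q * y ≤ 1 / (q - 1) := by simpa [Tmap] using h0.2
  have h1' : 1 ≤ q * y := by simpa [Tmap] using h1.1
  refine ⟨(div_le_iff₀' hq0).2 h1', ?_⟩
  rwa [mul_comm, ← div_div, le_div_iff₀' hq0]

/-- If `Ω_q(x)` is uncountable then there is a branching sequence `a` for `x`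
such that both `Ω_q(T_{q,0}(a(x)))` and `Ω_q(T_{q,1}(a(x)))` are uncountable. -/
theorem uncountable_branching
    (q x : ℝ) (hq : q ∈ Set.Ioo (1 : ℝ) 2) (hx : x ∈ Iq q)
    (hunc : ¬ (OmegaSet q x).Countable) :
    ∃ a : List (Fin 2), IsBranching q x a ∧
      ¬ (OmegaSet q (Tmap q 0 (wordMap q a x))).Countable ∧
      ¬ (OmegaSet q (Tmap q 1 (wordMap q a x))).Countable := by
  obtain ⟨a, ha, b, hb, n, hab, hne, hua, hub⟩ :=
    Set.exists_uncountable_prefix_split (s := {Tmap q 0, Tmap q 1}) (by simp)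
      (fun a ha n => ha.1 n) hunc
  wlog h : a n = Tmap q 0 ∧ b n = Tmap q 1 generalizing a b
  · refine this b hb a ha (fun k hk => (hab k hk).symm) hne.symm hub hua ?_
    rcases ha.1 n with h0 | h0 <;> rcases hb.1 n with h1 | h1 <;> simp_all
  obtain ⟨h0, h1⟩ := h
  have hdig : ∀ k, ∃ i : Fin 2, a k = Tmap q i := fun k =>
    (ha.1 k).elim (fun h => ⟨0, h⟩) fun h => ⟨1, h⟩
  choose d hd using hdig
  have hsa : applySeq a (n + 1) x = Tmap q 0 (applySeq a n x) := by rw [applySeq_succ, h0]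
  have hsb : applySeq b (n + 1) x = Tmap q 1 (applySeq a n x) := by
    rw [applySeq_succ, h1, applySeq_congr hab]
  refine ⟨(List.range n).map d, ⟨fun k _ => ?_, ?_⟩, ?_, ?_⟩
  · rw [← List.map_take, List.take_range, wordMap_map_range hd]
    exact applySeq_mem_Iq hx ha _
  · rw [wordMap_map_range hd]
    exact mem_Sq_of_Tmap_mem_Iq hq.1 (hsa ▸ ha.2 n) (hsb ▸ hb.2 n)
  · rw [wordMap_map_range hd, ← hsa]
    exact fun h => hua (countable_OmegaSet_prefix h)
  · rw [wordMap_map_range hd, ← hsb]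
    exact fun h => hub (countable_OmegaSet_prefix h)
end
end

section
/- Let q ∈ [q_{ℵ₀}, q_f) with q ≠ q_2, where q_2 ≈ 1.71064 is the unique root in (1,2) of x⁴ = 2x² + x + 1. Then q ∈ B_{ℵ₀} if and only if the set P_q = (T_{q,0}^{−1}(U_q) ∩ J_q) ∪ (T_{q,1}^{−1}(U_q) ∩ J_q) contains a q null infinite point. -/
noncomputable section

open Set

/-- Prepend a digit to a digit sequence. -/
def digitCons (i : Fin 2) (ε : ℕ → Fin 2) : ℕ → Fin 2
  | 0 => i
  | n + 1 => ε n

/-- The orbit of `x` under the maps `T_{q,ε 0}, T_{q,ε 1}, …`. -/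
def digitOrbit (q : ℝ) (ε : ℕ → Fin 2) (x : ℝ) : ℕ → ℝ
  | 0 => x
  | n + 1 => Tmap q (ε n) (digitOrbit q ε x n)

lemma Tmap_zero (q x : ℝ) : Tmap q 0 x = q * x := by simp [Tmap]

lemma Tmap_one (q x : ℝ) : Tmap q 1 x = q * x - 1 := by simp [Tmap]

lemma digitCons_head_tail (ε : ℕ → Fin 2) : digitCons (ε 0) (fun n => ε (n + 1)) = ε := by
  funext n; cases n <;> rfl

lemma digitCons_injective (i : Fin 2) : Function.Injective (digitCons i) := by
  intro ε δ h
  funext n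
  exact congrFun h (n + 1)

lemma digitOrbit_succ' (q : ℝ) (ε : ℕ → Fin 2) (x : ℝ) (n : ℕ) :
    digitOrbit q ε x (n + 1) = digitOrbit q (fun n => ε (n + 1)) (Tmap q (ε 0) x) n := by
  induction n with
  | zero => rfl
  | succ n ih => rw [digitOrbit, ih]; rfl

lemma exists_forall_digitOrbit {q : ℝ} {P : ℝ → Prop} (hP : ∀ y, P y → ∃ i, P (Tmap q i y))
    {x : ℝ} (hx : P x) : ∃ ε, ∀ n, P (digitOrbit q ε x n) := by
  classical
  choose! g hg using hP
  let s : ℕ → ℝ := fun n => (fun y => Tmap q (g y) y)^[n] x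
  have hs : ∀ n, digitOrbit q (fun n => g (s n)) x n = s n := by
    intro n
    induction n with
    | zero => rfl
    | succ n ih => rw [digitOrbit, ih]; simp only [s, Function.iterate_succ_apply']
  refine ⟨fun n => g (s n), fun n => ?_⟩
  induction n with
  | zero => exact hx
  | succ n ih =>
    have := hg _ ih
    rw [hs n] at this
    rw [digitOrbit, hs n]
    exact this

section Expansions

variable {q : ℝ}

lemma digit_le_one (i : Fin 2) : ((i : ℕ) : ℝ) ≤ 1 := by
  have : (i : ℕ) ≤ 1 := by omega
  exact_mod_cast this

lemma hasSum_geometric_digits (hq : 1 < q) :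
    HasSum (fun i : ℕ => 1 / q ^ (i + 1)) (1 / (q - 1)) := by
  have h := (hasSum_geometric_of_lt_one (r := q⁻¹) (by positivity)
    (inv_lt_one_of_one_lt₀ hq)).mul_left q⁻¹
  have hq1 : q - 1 ≠ 0 := by linarith
  have h1 : (fun i : ℕ => q⁻¹ * q⁻¹ ^ i) = fun i => 1 / q ^ (i + 1) := by
    funext i; rw [← pow_succ', inv_pow, one_div]
  have h2 : q⁻¹ * (1 - q⁻¹)⁻¹ = 1 / (q - 1) := by
    rw [← mul_inv, mul_sub, mul_inv_cancel₀ (by linarith), mul_one, one_div]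
  rwa [h1, h2] at h

lemma summable_digits (hq : 1 < q) (ε : ℕ → Fin 2) :
    Summable (fun i : ℕ => ((ε i : ℕ) : ℝ) / q ^ (i + 1)) := by
  refine (hasSum_geometric_digits hq).summable.of_nonneg_of_le (fun i => by positivity) fun i => ?_
  gcongr
  exact digit_le_one _

lemma seqVal_mem_Iq (hq : 1 < q) (ε : ℕ → Fin 2) : seqVal q ε ∈ Iq q := by
  refine ⟨tsum_nonneg fun i => by positivity, ?_⟩
  rw [← (hasSum_geometric_digits hq).tsum_eq]
  refine (summable_digits hq ε).tsum_le_tsum (fun i => ?_) (hasSum_geometric_digits hq).summable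
  gcongr
  exact digit_le_one _

lemma Tmap_seqVal (hq : 1 < q) (ε : ℕ → Fin 2) :
    Tmap q (ε 0) (seqVal q ε) = seqVal q (fun n => ε (n + 1)) := by
  have hq0 : q ≠ 0 := by linarith
  rw [Tmap, seqVal, (summable_digits hq ε).tsum_eq_zero_add, mul_add, ← tsum_mul_left, seqVal]
  have : ∀ i : ℕ, q * (((ε (i + 1) : ℕ) : ℝ) / q ^ (i + 1 + 1))
      = ((ε (i + 1) : ℕ) : ℝ) / q ^ (i + 1) := by
    intro i; rw [pow_succ' q (i + 1)]; field_simp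
  simp only [this]
  field_simp
  ring

lemma Tmap_injective (hq : 1 < q) (i : Fin 2) : Function.Injective (Tmap q i) := by
  intro x y h
  have hq0 : q ≠ 0 := by linarith
  simpa [Tmap, hq0] using h

lemma mem_SigmaSet_iff_tail (hq : 1 < q) {ε : ℕ → Fin 2} {x : ℝ} :
    ε ∈ SigmaSet q x ↔ (fun n => ε (n + 1)) ∈ SigmaSet q (Tmap q (ε 0) x) := by
  simp only [SigmaSet, mem_ofPred_eq, ← Tmap_seqVal hq, (Tmap_injective hq _).eq_iff]

lemma digitCons_mem_SigmaSet (hq : 1 < q) {i : Fin 2} {ε : ℕ → Fin 2} {x : ℝ} :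
    digitCons i ε ∈ SigmaSet q x ↔ ε ∈ SigmaSet q (Tmap q i x) :=
  mem_SigmaSet_iff_tail hq

lemma mem_Iq_of_mem_SigmaSet (hq : 1 < q) {ε : ℕ → Fin 2} {x : ℝ} (h : ε ∈ SigmaSet q x) :
    x ∈ Iq q := by
  rw [show x = seqVal q ε from h]; exact seqVal_mem_Iq hq ε

lemma digitOrbit_mem_Iq (hq : 1 < q) (n : ℕ) : ∀ {ε : ℕ → Fin 2} {x : ℝ}, ε ∈ SigmaSet q x →
    digitOrbit q ε x n ∈ Iq q := by
  induction n with
  | zero => intro ε x h; exact mem_Iq_of_mem_SigmaSet hq h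
  | succ n ih =>
    intro ε x h
    rw [digitOrbit_succ']
    exact ih ((mem_SigmaSet_iff_tail hq).1 h)

lemma eq_zero_of_forall_pow_mul_le (hq : 1 < q) {d C : ℝ} (h : ∀ n : ℕ, q ^ n * |d| ≤ C) :
    d = 0 := by
  by_contra hd
  have hd : 0 < |d| := abs_pos.2 hd
  obtain ⟨n, hn⟩ := pow_unbounded_of_one_lt (C / |d|) hq
  rw [div_lt_iff₀ hd] at hn
  linarith [h n]

lemma pow_mul_sub_seqVal (hq : 1 < q) (n : ℕ) : ∀ (ε : ℕ → Fin 2) (x : ℝ),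
    q ^ n * (x - seqVal q ε) = digitOrbit q ε x n - seqVal q (fun k => ε (k + n)) := by
  induction n with
  | zero => intro ε x; simp [digitOrbit]
  | succ n ih =>
    intro ε x
    have h := ih (fun n => ε (n + 1)) (Tmap q (ε 0) x)
    rw [← Tmap_seqVal hq] at h
    rw [digitOrbit_succ', ← show (fun k => ε (k + n + 1)) = fun k => ε (k + (n + 1)) from rfl, ← h]
    simp only [Tmap]
    ring

lemma mem_SigmaSet_iff_digitOrbit (hq : 1 < q) {ε : ℕ → Fin 2} {x : ℝ} :
    ε ∈ SigmaSet q x ↔ ∀ n, digitOrbit q ε x n ∈ Iq q := by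
  refine ⟨fun h n => digitOrbit_mem_Iq hq n h, fun h => ?_⟩
  have : x - seqVal q ε = 0 := by
    refine eq_zero_of_forall_pow_mul_le hq (C := 1 / (q - 1)) fun n => ?_
    have h1 := h n
    have h2 := seqVal_mem_Iq hq (fun k => ε (k + n))
    rw [← abs_of_pos (pow_pos (by linarith : 0 < q) n), ← abs_mul, pow_mul_sub_seqVal hq, abs_le]
    constructor <;> linarith [h1.1, h1.2, h2.1, h2.2]
  exact sub_eq_zero.1 this

lemma mem_Iq_of_Tmap_mem (hq : 1 < q) {i : Fin 2} {x : ℝ} (h : Tmap q i x ∈ Iq q) :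
    x ∈ Iq q := by
  have hd := digit_le_one i
  have hd0 : (0 : ℝ) ≤ ((i : ℕ) : ℝ) := by positivity
  obtain ⟨h0, h1⟩ := h
  simp only [Tmap] at h0 h1
  constructor
  · by_contra! hx; nlinarith
  · rw [le_div_iff₀ (by linarith)] at h1 ⊢
    by_contra! hx
    nlinarith

lemma Tmap_zero_mem_Iq_iff (hq : 1 < q) {x : ℝ} :
    Tmap q 0 x ∈ Iq q ↔ 0 ≤ x ∧ x ≤ 1 / (q * (q - 1)) := by
  have hq0 : 0 < q := by linarith
  have hq1 : 0 < q - 1 := by linarith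
  rw [Tmap_zero, Iq, mem_Icc, le_div_iff₀ hq1, le_div_iff₀ (by positivity)]
  refine and_congr (mul_nonneg_iff_of_pos_left hq0) ?_
  rw [show q * x * (q - 1) = x * (q * (q - 1)) by ring]

lemma Tmap_one_mem_Iq_iff (hq : 1 < q) {x : ℝ} :
    Tmap q 1 x ∈ Iq q ↔ 1 / q ≤ x ∧ x ≤ 1 / (q - 1) := by
  have hq0 : 0 < q := by linarith
  have hq1 : 0 < q - 1 := by linarith
  rw [Tmap_one, Iq, mem_Icc, le_div_iff₀ hq1, le_div_iff₀ hq1, div_le_iff₀ hq0]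
  constructor <;> rintro ⟨h0, h1⟩ <;> constructor <;> nlinarith

lemma mem_Sq_of_Tmap_mem (hq : 1 < q) {x : ℝ} (h : ∀ i, Tmap q i x ∈ Iq q) : x ∈ Sq q :=
  ⟨((Tmap_one_mem_Iq_iff hq).1 (h 1)).1, ((Tmap_zero_mem_Iq_iff hq).1 (h 0)).2⟩

lemma Tmap_mem_of_mem_Sq (hq : 1 < q) {x : ℝ} (h : x ∈ Sq q) (i : Fin 2) :
    Tmap q i x ∈ Iq q := by
  have hq0 : 0 < q := by linarith
  have hq1 : 0 < q - 1 := by linarith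
  have h2 : 1 / (q * (q - 1)) ≤ 1 / (q - 1) := by
    apply one_div_le_one_div_of_le hq1; nlinarith
  have h0 : 0 ≤ 1 / q := by positivity
  fin_cases i
  · exact (Tmap_zero_mem_Iq_iff hq).2 ⟨h0.trans h.1, h.2⟩
  · exact (Tmap_one_mem_Iq_iff hq).2 ⟨h.1, h.2.trans h2⟩

lemma exists_Tmap_mem_Iq (hq : 1 < q) (hq2 : q < 2) (x : ℝ) (hx : x ∈ Iq q) :
    ∃ i, Tmap q i x ∈ Iq q := by
  have hq0 : 0 < q := by linarith
  have hq1 : 0 < q - 1 := by linarith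
  by_cases h : x ≤ 1 / (q * (q - 1))
  · exact ⟨0, (Tmap_zero_mem_Iq_iff hq).2 ⟨hx.1, h⟩⟩
  · refine ⟨1, (Tmap_one_mem_Iq_iff hq).2 ⟨?_, hx.2⟩⟩
    refine le_trans ?_ (not_le.1 h).le
    apply one_div_le_one_div_of_le (by positivity)
    nlinarith

lemma SigmaSet_nonempty_iff (hq : 1 < q) (hq2 : q < 2) {x : ℝ} :
    (SigmaSet q x).Nonempty ↔ x ∈ Iq q := by
  refine ⟨fun ⟨ε, h⟩ => mem_Iq_of_mem_SigmaSet hq h, fun hx => ?_⟩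
  obtain ⟨ε, h⟩ := exists_forall_digitOrbit (exists_Tmap_mem_Iq hq hq2) hx
  exact ⟨ε, (mem_SigmaSet_iff_digitOrbit hq).2 h⟩

lemma UniqSet_iff (hq : 1 < q) (hq2 : q < 2) {x : ℝ} :
    x ∈ UniqSet q ↔ x ∈ Iq q ∧ (SigmaSet q x).Subsingleton := by
  refine and_congr_right fun hx => ⟨fun h ε hε δ hδ => h.unique hε hδ, fun h => ?_⟩
  obtain ⟨ε, hε⟩ := (SigmaSet_nonempty_iff hq hq2).2 hx
  exact ⟨ε, hε, fun δ hδ => h hδ hε⟩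

lemma applySeq_eq_digitOrbit (ε : ℕ → Fin 2) (x : ℝ) (n : ℕ) :
    applySeq (fun n => Tmap q (ε n)) n x = digitOrbit q ε x n := by
  induction n with
  | zero => rfl
  | succ n ih => rw [digitOrbit, ← ih]; simp [applySeq, List.range_succ]

lemma OmegaSet_eq_image (hq : 1 < q) (x : ℝ) :
    OmegaSet q x = (fun ε n => Tmap q (ε n)) '' SigmaSet q x := by
  ext a
  constructor
  · rintro ⟨h1, h2⟩
    have : ∀ n, ∃ i, Tmap q i = a n := fun n => (h1 n).elim (fun h => ⟨0, h.symm⟩)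
      fun h => ⟨1, h.symm⟩
    choose ε hε using this
    have ha : a = fun n => Tmap q (ε n) := funext fun n => (hε n).symm
    subst ha
    simp only [applySeq_eq_digitOrbit] at h2
    refine ⟨ε, (mem_SigmaSet_iff_digitOrbit hq).2 fun n => ?_, rfl⟩
    cases n with
    | zero => exact mem_Iq_of_Tmap_mem hq (h2 0)
    | succ n => exact h2 n
  · rintro ⟨ε, hε, rfl⟩
    refine ⟨fun n => ?_, fun n => ?_⟩
    · rcases Fin.exists_fin_two.1 ⟨ε n, rfl⟩ with h | h <;> simp [h]
    · rw [applySeq_eq_digitOrbit]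
      exact digitOrbit_mem_Iq hq _ hε

lemma OmegaSet_finite_iff (hq : 1 < q) (x : ℝ) :
    (OmegaSet q x).Finite ↔ (SigmaSet q x).Finite := by
  rw [OmegaSet_eq_image hq, Set.finite_image_iff]
  refine Function.Injective.injOn fun ε δ h => funext fun n => ?_
  have h := congrFun (congrFun h n) 0
  simpa [Tmap, Fin.ext_iff] using h

lemma SigmaSet_eq_union (hq : 1 < q) (x : ℝ) : SigmaSet q x =
    digitCons 0 '' SigmaSet q (Tmap q 0 x) ∪ digitCons 1 '' SigmaSet q (Tmap q 1 x) := by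
  ext ε
  constructor
  · intro h
    have h' := (mem_SigmaSet_iff_tail hq).1 h
    rcases Fin.exists_fin_two.1 ⟨ε 0, rfl⟩ with h0 | h0
    · left; rw [← h0]; exact ⟨_, h', digitCons_head_tail ε⟩
    · right; rw [← h0]; exact ⟨_, h', digitCons_head_tail ε⟩
  · rintro (⟨δ, h, rfl⟩ | ⟨δ, h, rfl⟩) <;> exact (digitCons_mem_SigmaSet hq).2 h

lemma digitCons_image_subset (hq : 1 < q) (i : Fin 2) (x : ℝ) :
    digitCons i '' SigmaSet q (Tmap q i x) ⊆ SigmaSet q x := by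
  rintro _ ⟨δ, h, rfl⟩; exact (digitCons_mem_SigmaSet hq).2 h

lemma SigmaSet_finite_of_Tmap (hq : 1 < q) {x : ℝ} (h : ∀ i, (SigmaSet q (Tmap q i x)).Finite) :
    (SigmaSet q x).Finite := by
  rw [SigmaSet_eq_union hq]; exact ((h 0).image _).union ((h 1).image _)

lemma exists_Tmap_infinite (hq : 1 < q) (x : ℝ) (h : (SigmaSet q x).Infinite) :
    ∃ i, (SigmaSet q (Tmap q i x)).Infinite := by
  by_contra! h'
  exact h (SigmaSet_finite_of_Tmap hq fun i => by simpa using h' i)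

lemma SigmaSet_infinite_of_Tmap (hq : 1 < q) {x : ℝ} {i : Fin 2}
    (h : (SigmaSet q (Tmap q i x)).Infinite) : (SigmaSet q x).Infinite :=
  (h.image (digitCons_injective i).injOn).mono (digitCons_image_subset hq i x)

lemma SigmaSet_subsingleton_Tmap (hq : 1 < q) {x : ℝ} (h : (SigmaSet q x).Subsingleton)
    (i : Fin 2) : (SigmaSet q (Tmap q i x)).Subsingleton := fun _ hε _ hδ =>
  digitCons_injective i (h ((digitCons_mem_SigmaSet hq).2 hε) ((digitCons_mem_SigmaSet hq).2 hδ))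

lemma not_mem_Sq_of_subsingleton (hq : 1 < q) (hq2 : q < 2) {x : ℝ}
    (h : (SigmaSet q x).Subsingleton) : x ∉ Sq q := by
  intro hx
  obtain ⟨ε, hε⟩ := (SigmaSet_nonempty_iff hq hq2).2 (Tmap_mem_of_mem_Sq hq hx 0)
  obtain ⟨δ, hδ⟩ := (SigmaSet_nonempty_iff hq hq2).2 (Tmap_mem_of_mem_Sq hq hx 1)
  have := congrFun (h ((digitCons_mem_SigmaSet hq).2 hε) ((digitCons_mem_SigmaSet hq).2 hδ)) 0
  simp [digitCons] at this

end Expansions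

section NullInfinite

variable {q : ℝ}

/-- The digit sequences along which every point of the orbit of `x` has infinitely many
expansions. -/
def infiniteTails (q x : ℝ) : Set (ℕ → Fin 2) :=
  {ε | ∀ n, (SigmaSet q (digitOrbit q ε x n)).Infinite}

/-- Every point reached from `x` by a finite word has a child with finitely many expansions. -/
def HereditarilyThin (q x : ℝ) : Prop :=
  ∀ a : List (Fin 2), ∃ i, (SigmaSet q (Tmap q i (wordMap q a x))).Finite

lemma HereditarilyThin.Tmap {x : ℝ} (h : HereditarilyThin q x) (i : Fin 2) :
    HereditarilyThin q (Tmap q i x) := fun a => h (i :: a)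

lemma mem_infiniteTails_iff_tail (hq : 1 < q) {ε : ℕ → Fin 2} {x : ℝ} :
    ε ∈ infiniteTails q x ↔ (fun n => ε (n + 1)) ∈ infiniteTails q (Tmap q (ε 0) x) := by
  constructor
  · intro h n
    rw [← digitOrbit_succ']
    exact h (n + 1)
  · intro h n
    cases n with
    | zero => exact SigmaSet_infinite_of_Tmap hq (h 0)
    | succ n => rw [digitOrbit_succ']; exact h n

lemma digitCons_mem_infiniteTails (hq : 1 < q) {i : Fin 2} {ε : ℕ → Fin 2} {x : ℝ} :
    digitCons i ε ∈ infiniteTails q x ↔ ε ∈ infiniteTails q (Tmap q i x) :=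
  mem_infiniteTails_iff_tail hq

lemma infiniteTails_subset (hq : 1 < q) (x : ℝ) : infiniteTails q x ⊆ SigmaSet q x :=
  fun _ h => (mem_SigmaSet_iff_digitOrbit hq).2 fun n =>
    (h n).nonempty.elim fun _ hδ => mem_Iq_of_mem_SigmaSet hq hδ

lemma infiniteTails_nonempty (hq : 1 < q) {x : ℝ} (h : (SigmaSet q x).Infinite) :
    (infiniteTails q x).Nonempty :=
  exists_forall_digitOrbit (exists_Tmap_infinite hq) h

lemma isLocallyConstant_digitOrbit (x : ℝ) (n : ℕ) :
    IsLocallyConstant fun ε : ℕ → Fin 2 => digitOrbit q ε x n := by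
  induction n with
  | zero => exact IsLocallyConstant.const x
  | succ n ih =>
    have h : IsLocallyConstant fun ε : ℕ → Fin 2 => ε n :=
      (IsLocallyConstant.of_discrete id).comp_continuous (continuous_apply n)
    exact h.comp₂ ih (Tmap q)

lemma isClosed_infiniteTails (x : ℝ) : IsClosed (infiniteTails q x) := by
  have : infiniteTails q x = ⋂ n, (fun ε => digitOrbit q ε x n) ⁻¹'
      {y | (SigmaSet q y).Infinite} := by
    ext ε; simp [infiniteTails]
  rw [this]
  exact isClosed_iInter fun n => ⟨by
    rw [← preimage_compl]
    exact isLocallyConstant_digitOrbit x n _⟩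

lemma exists_isolated_of_countable {K : Set (ℕ → Fin 2)} (hK : IsClosed K) (hc : K.Countable)
    (hne : K.Nonempty) : ∃ ε ∈ K, ∃ n : ℕ, ∀ δ ∈ K, (∀ k < n, δ k = ε k) → δ = ε := by
  have := hc.to_subtype
  have := hne.to_subtype
  have : CompactSpace K := isCompact_iff_compactSpace.1 hK.isCompact
  obtain ⟨⟨ε, hε⟩, y, hy⟩ := nonempty_interior_of_iUnion_of_closed (ι := K)
    (f := fun y => ({y} : Set K)) (fun y => isClosed_singleton) (iUnion_of_singleton _)
  obtain rfl : y = ⟨ε, hε⟩ := mem_singleton_iff.1 (interior_subset hy)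
  obtain ⟨U, hU, hUe⟩ := isOpen_induced_iff.1 (isOpen_interior (s := {(⟨ε, hε⟩ : K)}))
  have hεU : ε ∈ U := by
    rw [← hUe] at hy; exact hy
  obtain ⟨v, ⟨y, n, rfl⟩, h1, h2⟩ :=
    (PiNat.isTopologicalBasis_cylinders fun _ : ℕ => Fin 2).exists_subset_of_mem_open hεU hU
  refine ⟨ε, hε, n, fun δ hδ h => ?_⟩
  have hδU : (⟨δ, hδ⟩ : K) ∈ interior {(⟨ε, hε⟩ : K)} := by
    rw [← hUe]
    exact h2 fun k hk => (h k hk).trans (h1 k hk)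
  exact congrArg Subtype.val (interior_subset hδU : (⟨δ, hδ⟩ : K) ∈ {(⟨ε, hε⟩ : K)})

lemma exists_infiniteTails_subsingleton (hq : 1 < q) (n : ℕ) : ∀ (x : ℝ) (ε : ℕ → Fin 2),
    ε ∈ infiniteTails q x → (∀ δ ∈ infiniteTails q x, (∀ k < n, δ k = ε k) → δ = ε) →
    ∃ y, (SigmaSet q y).Infinite ∧ (infiniteTails q y).Subsingleton := by
  induction n with
  | zero =>
    intro x ε hε h
    exact ⟨x, hε 0, fun δ hδ γ hγ => (h δ hδ (by simp)).trans (h γ hγ (by simp)).symm⟩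
  | succ n ih =>
    intro x ε hε h
    refine ih (Tmap q (ε 0) x) _ ((mem_infiniteTails_iff_tail hq).1 hε) fun δ hδ hk => ?_
    rw [← h (digitCons (ε 0) δ) ((digitCons_mem_infiniteTails hq).2 hδ)]
    · rfl
    · intro k hk'
      cases k with
      | zero => rfl
      | succ k => exact hk k (by omega)

lemma hereditarilyThin_of_subsingleton (hq : 1 < q) {x : ℝ}
    (h : (infiniteTails q x).Subsingleton) : HereditarilyThin q x := by
  intro a
  induction a generalizing x with
  | nil =>
    by_contra! h'
    obtain ⟨ε, hε⟩ := infiniteTails_nonempty hq (h' 0)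
    obtain ⟨δ, hδ⟩ := infiniteTails_nonempty hq (h' 1)
    have := congrFun (h ((digitCons_mem_infiniteTails hq).2 hε)
      ((digitCons_mem_infiniteTails hq).2 hδ)) 0
    simp [digitCons] at this
  | cons i a ih =>
    refine ih (x := Tmap q i x) fun ε hε δ hδ => digitCons_injective i ?_
    exact h ((digitCons_mem_infiniteTails hq).2 hε) ((digitCons_mem_infiniteTails hq).2 hδ)

lemma exists_hereditarilyThin (hq : 1 < q) {x : ℝ} (hc : (SigmaSet q x).Countable)
    (hi : (SigmaSet q x).Infinite) : ∃ y, (SigmaSet q y).Infinite ∧ HereditarilyThin q y := by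
  obtain ⟨ε, hε, n, h⟩ := exists_isolated_of_countable (isClosed_infiniteTails x)
    (hc.mono (infiniteTails_subset hq x)) (infiniteTails_nonempty hq hi)
  obtain ⟨y, h1, h2⟩ := exists_infiniteTails_subsingleton hq n x ε hε h
  exact ⟨y, h1, hereditarilyThin_of_subsingleton hq h2⟩

lemma HereditarilyThin.infiniteTails_eq (hq : 1 < q) (n : ℕ) : ∀ {x : ℝ},
    HereditarilyThin q x → ∀ {ε δ : ℕ → Fin 2}, ε ∈ infiniteTails q x → δ ∈ infiniteTails q x →
    ε n = δ n := by
  have h0 : ∀ {x : ℝ}, HereditarilyThin q x → ∀ {ε δ : ℕ → Fin 2}, ε ∈ infiniteTails q x →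
      δ ∈ infiniteTails q x → ε 0 = δ 0 := by
    intro x hx ε δ hε hδ
    obtain ⟨i, hi⟩ := hx []
    have h : ∀ {ε}, ε ∈ infiniteTails q x → ε 0 ≠ i := by
      rintro ε hε rfl
      exact hε 1 hi
    have := h hε
    have := h hδ
    omega
  induction n with
  | zero => exact h0
  | succ n ih =>
    intro x hx ε δ hε hδ
    have h1 := (mem_infiniteTails_iff_tail hq).1 hε
    have h2 := (mem_infiniteTails_iff_tail hq).1 hδ
    rw [← h0 hx hε hδ] at h2
    exact ih (hx.Tmap _) h1 h2

lemma countable_finite_digitOrbit (hq : 1 < q) (n : ℕ) : ∀ x : ℝ,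
    {ε ∈ SigmaSet q x | (SigmaSet q (digitOrbit q ε x n)).Finite}.Countable := by
  induction n with
  | zero =>
    intro x
    by_cases h : (SigmaSet q x).Finite
    · exact h.countable.mono fun ε hε => hε.1
    · exact countable_empty.mono fun ε hε => h hε.2
  | succ n ih =>
    intro x
    refine (countable_iUnion fun i => (ih (Tmap q i x)).image (digitCons i)).mono fun ε hε => ?_
    refine mem_iUnion.2 ⟨ε 0, _, ⟨(mem_SigmaSet_iff_tail hq).1 hε.1, ?_⟩, digitCons_head_tail ε⟩
    rw [← digitOrbit_succ']
    exact hε.2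

lemma HereditarilyThin.countable (hq : 1 < q) {x : ℝ} (hx : HereditarilyThin q x) :
    (SigmaSet q x).Countable := by
  have h1 : (infiniteTails q x).Countable := Set.Subsingleton.countable fun ε hε δ hδ =>
    funext fun n => hx.infiniteTails_eq hq n hε hδ
  refine (h1.union (countable_iUnion fun n => countable_finite_digitOrbit hq n x)).mono ?_
  intro ε hε
  by_cases h : ε ∈ infiniteTails q x
  · exact Or.inl h
  · obtain ⟨n, hn⟩ := not_forall.1 h
    exact Or.inr (mem_iUnion.2 ⟨n, hε, not_infinite.1 hn⟩)

lemma SigmaSet_infinite_of_wordMap (hq : 1 < q) (a : List (Fin 2)) : ∀ {x : ℝ},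
    (SigmaSet q (wordMap q a x)).Infinite → (SigmaSet q x).Infinite := by
  induction a with
  | nil => exact id
  | cons i a ih => exact fun h => SigmaSet_infinite_of_Tmap hq (ih h)

lemma wordMap_take_drop (a : List (Fin 2)) (k : ℕ) (x : ℝ) :
    wordMap q (a.drop k) (wordMap q (a.take k) x) = wordMap q a x := by
  rw [wordMap, wordMap, ← List.foldl_append, List.take_append_drop, wordMap]

lemma not_infinite_zero (hq : 1 < q) : ¬ (SigmaSet q 0).Infinite := by
  refine not_infinite.2 (Set.Subsingleton.finite fun ε hε δ hδ => ?_)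
  have h : ∀ n : ℕ, ∀ ε ∈ SigmaSet q 0, ε n = 0 := by
    have h0 : ∀ ε ∈ SigmaSet q 0, ε 0 = 0 := by
      intro ε hε
      by_contra h
      have h1 := (mem_Iq_of_mem_SigmaSet hq ((mem_SigmaSet_iff_tail hq).1 hε)).1
      rw [show ε 0 = 1 by omega, Tmap_one] at h1
      linarith
    intro n
    induction n with
    | zero => exact h0
    | succ n ih =>
      intro ε hε
      have h1 := (mem_SigmaSet_iff_tail hq).1 hε
      rw [h0 ε hε, Tmap_zero, mul_zero] at h1
      exact ih _ h1
  funext n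
  rw [h n ε hε, h n δ hδ]

lemma exists_mem_Sq (hq : 1 < q) {x : ℝ} (hi : (SigmaSet q x).Infinite)
    (ht : HereditarilyThin q x) :
    ∃ z ∈ Sq q, (SigmaSet q z).Infinite ∧ HereditarilyThin q z := by
  obtain ⟨ε, hε, δ, hδ, hne⟩ := hi.nontrivial
  obtain ⟨n, hn⟩ := Function.ne_iff.1 hne
  clear hne
  induction n generalizing x ε δ with
  | zero =>
    refine ⟨x, mem_Sq_of_Tmap_mem hq fun i => ?_, hi, ht⟩
    have h1 := mem_Iq_of_mem_SigmaSet hq ((mem_SigmaSet_iff_tail hq).1 hε)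
    have h2 := mem_Iq_of_mem_SigmaSet hq ((mem_SigmaSet_iff_tail hq).1 hδ)
    rcases (by omega : i = ε 0 ∨ i = δ 0) with rfl | rfl <;> assumption
  | succ n ih =>
    by_cases hx : x ∈ Sq q
    · exact ⟨x, hx, hi, ht⟩
    obtain ⟨i, hi'⟩ := exists_Tmap_infinite hq x hi
    have h : ∀ ε ∈ SigmaSet q x, ε 0 = i := by
      intro ε hε
      by_contra h
      refine hx (mem_Sq_of_Tmap_mem hq fun j => ?_)
      by_cases hj : j = i
      · subst hj
        obtain ⟨γ, hγ⟩ := hi'.nonempty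
        exact mem_Iq_of_mem_SigmaSet hq hγ
      · rw [show j = ε 0 by omega]
        exact mem_Iq_of_mem_SigmaSet hq ((mem_SigmaSet_iff_tail hq).1 hε)
    have h1 := (mem_SigmaSet_iff_tail hq).1 hε
    have h2 := (mem_SigmaSet_iff_tail hq).1 hδ
    rw [h _ hε] at h1
    rw [h _ hδ] at h2
    exact ih hi' (ht.Tmap i) _ h1 _ h2 hn

end NullInfinite

section Reflection

variable {q : ℝ}

/-- The reflection `x ↦ 1/(q-1) - x` of `I_q`. -/
def reflect (q x : ℝ) : ℝ := 1 / (q - 1) - x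

lemma reflect_reflect (q x : ℝ) : reflect q (reflect q x) = x := sub_sub_cancel _ _

lemma Tmap_rev_reflect (hq : 1 < q) (i : Fin 2) (x : ℝ) :
    Tmap q i.rev (reflect q x) = reflect q (Tmap q i x) := by
  have hq1 : q - 1 ≠ 0 := by linarith
  have h : (((i.rev : Fin 2) : ℕ) : ℝ) = 1 - ((i : ℕ) : ℝ) := by
    fin_cases i <;> simp
  rw [Tmap, h, Tmap, reflect, reflect]
  field_simp
  ring

lemma reflect_mem_Iq {x : ℝ} : reflect q x ∈ Iq q ↔ x ∈ Iq q := by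
  simp only [Iq, reflect, mem_Icc]
  constructor <;> rintro ⟨h0, h1⟩ <;> constructor <;> linarith

lemma reflect_mem_Sq (hq : 1 < q) {x : ℝ} : reflect q x ∈ Sq q ↔ x ∈ Sq q := by
  have hq1 : q - 1 ≠ 0 := by linarith
  have h : 1 / (q - 1) - 1 / q = 1 / (q * (q - 1)) := by field_simp; ring
  simp only [Sq, reflect, mem_Icc, ← h]
  constructor <;> rintro ⟨h0, h1⟩ <;> constructor <;> linarith

lemma reflect_mem_Jq (hq : 1 < q) {x : ℝ} : reflect q x ∈ Jq q ↔ x ∈ Jq q := by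
  have hq1 : q - 1 ≠ 0 := by linarith
  have hq4 : q ^ 4 - 1 ≠ 0 := by
    have := one_lt_pow₀ hq (n := 4) (by norm_num)
    linarith
  have h : 1 / (q - 1) - (q + q ^ 2) / (q ^ 4 - 1) = (1 + q ^ 3) / (q ^ 4 - 1) := by
    field_simp; ring
  simp only [Jq, reflect, mem_Icc, ← h]
  constructor <;> rintro ⟨h0, h1⟩ <;> constructor <;> linarith

lemma digitOrbit_reflect (hq : 1 < q) (ε : ℕ → Fin 2) (x : ℝ) (n : ℕ) :
    digitOrbit q (fun n => (ε n).rev) (reflect q x) n = reflect q (digitOrbit q ε x n) := by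
  induction n with
  | zero => rfl
  | succ n ih => rw [digitOrbit, ih, Tmap_rev_reflect hq, digitOrbit]

lemma SigmaSet_reflect (hq : 1 < q) (x : ℝ) :
    SigmaSet q (reflect q x) = (fun ε n => (ε n).rev) '' SigmaSet q x := by
  have h : ∀ (y : ℝ) (ε), ε ∈ SigmaSet q y → (fun n => (ε n).rev) ∈ SigmaSet q (reflect q y) := by
    intro y ε hε
    refine (mem_SigmaSet_iff_digitOrbit hq).2 fun n => ?_
    rw [digitOrbit_reflect hq, reflect_mem_Iq]
    exact digitOrbit_mem_Iq hq n hε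
  ext ε
  constructor
  · intro hε
    have := h _ _ hε
    rw [reflect_reflect] at this
    exact ⟨_, this, by simp⟩
  · rintro ⟨δ, hδ, rfl⟩
    exact h _ _ hδ

lemma revDigits_injective : Function.Injective fun (ε : ℕ → Fin 2) n => (ε n).rev :=
  fun _ _ h => funext fun n => Fin.rev_injective (congrFun h n)

lemma SigmaSet_reflect_finite (hq : 1 < q) {x : ℝ} :
    (SigmaSet q (reflect q x)).Finite ↔ (SigmaSet q x).Finite := by
  rw [SigmaSet_reflect hq, finite_image_iff revDigits_injective.injOn]

lemma SigmaSet_reflect_subsingleton (hq : 1 < q) {x : ℝ} (h : (SigmaSet q x).Subsingleton) :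
    (SigmaSet q (reflect q x)).Subsingleton := by
  rw [SigmaSet_reflect hq]; exact h.image _

lemma wordMap_reflect (hq : 1 < q) (a : List (Fin 2)) : ∀ x : ℝ,
    wordMap q (a.map Fin.rev) (reflect q x) = reflect q (wordMap q a x) := by
  induction a with
  | nil => intro x; rfl
  | cons i a ih =>
    intro x
    have := ih (Tmap q i x)
    rw [← Tmap_rev_reflect hq] at this
    exact this

lemma HereditarilyThin.reflect (hq : 1 < q) {x : ℝ} (h : HereditarilyThin q x) :
    HereditarilyThin q (reflect q x) := by
  intro a
  obtain ⟨i, hi⟩ := h (a.map Fin.rev)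
  refine ⟨i.rev, ?_⟩
  have : a = (a.map Fin.rev).map Fin.rev := by simp [Function.comp_def]
  rw [this, wordMap_reflect hq, Tmap_rev_reflect hq, SigmaSet_reflect_finite hq]
  exact hi

end Reflection

section NullInfinite

variable {q : ℝ}

lemma mem_Ioo_of_infinite (hq : 1 < q) {x : ℝ} (h : (SigmaSet q x).Infinite) :
    x ∈ Ioo 0 (1 / (q - 1)) := by
  obtain ⟨ε, hε⟩ := h.nonempty
  have hx := mem_Iq_of_mem_SigmaSet hq hε
  refine ⟨hx.1.lt_of_ne ?_, hx.2.lt_of_ne ?_⟩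
  · rintro rfl; exact not_infinite_zero hq h
  · rintro rfl
    refine h ((SigmaSet_reflect_finite hq).1 ?_)
    rw [reflect, sub_self]
    exact not_infinite.1 (not_infinite_zero hq)

lemma nullInfinite_iff (hq : 1 < q) {x : ℝ} :
    NullInfinite q x ↔ (SigmaSet q x).Infinite ∧ HereditarilyThin q x := by
  simp only [NullInfinite, Set.Infinite, OmegaSet_finite_iff hq]
  constructor
  · rintro ⟨-, hi, h⟩
    refine ⟨hi, fun a => ?_⟩
    by_contra! h'
    have hI : ∀ y, (SigmaSet q y).Infinite → y ∈ Iq q := fun y hy =>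
      hy.nonempty.elim fun ε hε => mem_Iq_of_mem_SigmaSet hq hε
    obtain ⟨i, hi⟩ := h a ⟨fun k _ => hI _ (SigmaSet_infinite_of_wordMap hq (a.drop k)
      (by rw [wordMap_take_drop]; exact SigmaSet_infinite_of_Tmap hq (h' 0))),
      mem_Sq_of_Tmap_mem hq fun i => hI _ (h' i)⟩
    exact h' i hi
  · rintro ⟨hi, h⟩
    exact ⟨mem_Ioo_of_infinite hq hi, hi, fun a _ => h a⟩

end NullInfinite

section UniqueExpansions

variable {q : ℝ}

/-- Between the golden ratio and `q_f`, a point of `U_q` lying to the right of `S_q` and below `1`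
is the fixed point of `T_{q,0} ∘ T_{q,1}`. -/
lemma eq_of_subsingleton_right (hq : 1 < q) (hq2 : q < 2) (hG : q + 1 < q ^ 2)
    (hf : q ^ 3 < 2 * q ^ 2 - q + 1) {x : ℝ} (h1 : 1 / (q * (q - 1)) < x) (h2 : x < 1)
    (hs : (SigmaSet q x).Subsingleton) : x = q / (q ^ 2 - 1) := by
  have hq1 : 0 < q - 1 := by linarith
  have hqq : 0 < q ^ 2 - 1 := by nlinarith
  have key : ∀ n : ℕ, ∀ x : ℝ, 1 / (q * (q - 1)) < x → x < 1 → (SigmaSet q x).Subsingleton →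
      (q ^ 2) ^ n * |x - q / (q ^ 2 - 1)| ≤ 1 := by
    intro n
    induction n with
    | zero =>
      intro x h1 h2 _
      have h0 : 0 ≤ 1 / (q * (q - 1)) := by positivity
      have h3 : 0 ≤ q / (q ^ 2 - 1) := by positivity
      have h4 : q / (q ^ 2 - 1) ≤ 1 := by rw [div_le_one hqq]; linarith
      rw [pow_zero, one_mul, abs_le]
      constructor <;> linarith
    | succ n ih =>
      intro x h1 h2 hs
      rw [div_lt_iff₀ (by positivity)] at h1
      have hs1 := SigmaSet_subsingleton_Tmap hq hs 1
      have hs2 := SigmaSet_subsingleton_Tmap hq hs1 0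
      rw [Tmap_one] at hs1
      rw [Tmap_one, Tmap_zero] at hs2
      have hl : q * x - 1 < 1 / q := by
        have hn := not_mem_Sq_of_subsingleton hq hq2 hs1
        by_contra! hc
        refine hn ⟨hc, ?_⟩
        rw [le_div_iff₀ (by positivity)]
        nlinarith [mul_lt_mul_of_pos_right h2 (by positivity : 0 < q * (q * (q - 1)))]
      have hr : 1 / (q * (q - 1)) < q * (q * x - 1) := by
        have hn := not_mem_Sq_of_subsingleton hq hq2 hs2
        by_contra! hc
        refine hn ⟨?_, hc⟩
        rw [div_le_iff₀ (by positivity)]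
        have h3 : q ^ 2 * 1 ≤ q ^ 2 * (x * (q * (q - 1))) :=
          mul_le_mul_of_nonneg_left h1.le (by positivity)
        by_contra! hc'
        have h4 := mul_lt_mul_of_pos_right hc' hq1
        nlinarith
      rw [lt_div_iff₀ (by positivity)] at hl
      have h := ih _ hr (by linarith) hs2
      have he : q * (q * x - 1) - q / (q ^ 2 - 1) = q ^ 2 * (x - q / (q ^ 2 - 1)) := by
        field_simp; ring
      rw [he, abs_mul, abs_of_pos (by positivity : 0 < q ^ 2)] at h
      rw [pow_succ, mul_assoc]
      exact h
  have := eq_zero_of_forall_pow_mul_le (q := q ^ 2) (by linarith) fun n => key n x h1 h2 hs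
  linarith

lemma exists_of_subsingleton_left (hq : 1 < q) (hq2 : q < 2) (hG : q + 1 < q ^ 2)
    (hf : q ^ 3 < 2 * q ^ 2 - q + 1) {x : ℝ} (h1 : 0 < x) (h2 : x < 1 / q)
    (hs : (SigmaSet q x).Subsingleton) : ∃ k : ℕ, x = (1 / q) ^ k * (1 / (q ^ 2 - 1)) := by
  have hq0 : 0 < q := by linarith
  have hq1 : 0 < q - 1 := by linarith
  have hqq : 0 < q ^ 2 - 1 := by nlinarith
  obtain ⟨n, hn⟩ := pow_unbounded_of_one_lt (1 / x) hq
  rw [div_lt_iff₀ h1] at hn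
  induction n generalizing x with
  | zero =>
    have : 1 / q < 1 := by rw [div_lt_one hq0]; exact hq
    simp at hn; linarith
  | succ n ih =>
    have hs0 := SigmaSet_subsingleton_Tmap hq hs 0
    rw [Tmap_zero] at hs0
    by_cases h : q * x < 1 / q
    · obtain ⟨k, hk⟩ := ih (by positivity) h hs0 (by rw [pow_succ] at hn; linarith)
      refine ⟨k + 1, ?_⟩
      rw [pow_succ', mul_assoc, ← hk]
      field_simp
    · rw [lt_div_iff₀ hq0] at h2
      have := eq_of_subsingleton_right hq hq2 hG hf (x := q * x) (by
        by_contra! hc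
        exact not_mem_Sq_of_subsingleton hq hq2 hs0 ⟨not_lt.1 h, hc⟩) (by linarith) hs0
      refine ⟨0, ?_⟩
      rw [eq_div_iff hqq.ne'] at this
      rw [pow_zero, one_mul, eq_div_iff hqq.ne']
      apply mul_left_cancel₀ hq0.ne'
      linarith

lemma one_div_pow_le (hq : 1 < q) {k l : ℕ} (h : l ≤ k) : (1 / q) ^ k ≤ (1 / q) ^ l := by
  rw [one_div_pow, one_div_pow]
  exact one_div_le_one_div_of_le (by positivity) (pow_le_pow_right₀ hq.le h)

/-- The equation governing which bases below `q_f` have a point with exactly two expansions. -/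
lemma pow_add_pow_eq (hq : 1 < q) (hG : q + 1 < q ^ 2)
    (hf : q ^ 3 < 2 * q ^ 2 - q + 1) {k l : ℕ} (hkl : k ≤ l)
    (h : (1 / q) ^ k + (1 / q) ^ l = 2 + q - q ^ 2) : q ^ 4 = 2 * q ^ 2 + q + 1 := by
  have hq0 : 0 < q := by linarith
  have hl0 : 0 < (1 / q) ^ l := by positivity
  have hk : k ≠ 0 := by
    rintro rfl; rw [pow_zero] at h; linarith
  by_cases hk1 : k = 1
  · subst hk1
    rw [pow_one] at h
    by_cases hl2 : l ≤ 2
    · have := one_div_pow_le hq hl2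
      have h' : 1 / q + (1 / q) ^ 2 ≤ 2 + q - q ^ 2 := by linarith
      have := mul_le_mul_of_nonneg_right h' (by positivity : 0 ≤ q ^ 2)
      have e : (1 / q + (1 / q) ^ 2) * q ^ 2 = q + 1 := by field_simp
      rw [e] at this
      nlinarith [mul_pos (by linarith : 0 < q ^ 2 - q - 1) (by nlinarith : 0 < q ^ 2 - 1)]
    by_cases hl3 : l = 3
    · subst hl3
      have e : (1 / q + (1 / q) ^ 3) * q ^ 3 = q ^ 2 + 1 := by field_simp
      rw [h] at e
      have : (q - 1) * (q ^ 4 - (2 * q ^ 2 + q + 1)) = 0 := by linear_combination -e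
      rcases mul_eq_zero.1 this with h | h <;> linarith
    · have := one_div_pow_le hq (show 4 ≤ l by omega)
      have h' : 2 + q - q ^ 2 ≤ 1 / q + (1 / q) ^ 4 := by linarith
      have := mul_le_mul_of_nonneg_right h' (by positivity : 0 ≤ q ^ 4)
      have e : (1 / q + (1 / q) ^ 4) * q ^ 4 = q ^ 3 + 1 := by field_simp
      rw [e] at this
      have h3 : 0 < q ^ 3 + q ^ 2 - q - 1 := by nlinarith [pow_pos hq0 3]
      nlinarith [mul_pos (by linarith : 0 < 2 * q ^ 2 - q + 1 - q ^ 3) h3]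
  · have h1 := one_div_pow_le hq (show 2 ≤ k by omega)
    have h2 := one_div_pow_le hq (show 2 ≤ l by omega)
    have h' : 2 + q - q ^ 2 ≤ (1 / q) ^ 2 + (1 / q) ^ 2 := by linarith
    have := mul_le_mul_of_nonneg_right h' (by positivity : 0 ≤ q ^ 2)
    have e : ((1 / q) ^ 2 + (1 / q) ^ 2) * q ^ 2 = 2 := by field_simp; norm_num
    rw [e] at this
    nlinarith

lemma one_div_pow_ne (hq : 1 < q) (hG : q + 1 < q ^ 2)
    (hf : q ^ 3 < 2 * q ^ 2 - q + 1) (k : ℕ) : (1 / q) ^ k ≠ 2 + q - q ^ 2 := by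
  have hq0 : 0 < q := by linarith
  intro h
  by_cases hk : k = 0
  · subst hk; rw [pow_zero] at h; linarith
  · have h1 := one_div_pow_le hq (show 1 ≤ k by omega)
    rw [h, pow_one] at h1
    have := mul_le_mul_of_nonneg_right h1 hq0.le
    have e : 1 / q * q = 1 := by field_simp
    rw [e] at this
    nlinarith

/-- No point of the switch region has two children with unique expansions. -/
lemma not_both_subsingleton (hq : 1 < q) (hq2 : q < 2) (hG : q + 1 < q ^ 2)
    (hf : q ^ 3 < 2 * q ^ 2 - q + 1) (hne : q ^ 4 ≠ 2 * q ^ 2 + q + 1) {x : ℝ} (hx : x ∈ Sq q)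
    (h0 : (SigmaSet q (Tmap q 0 x)).Subsingleton) :
    ¬ (SigmaSet q (Tmap q 1 x)).Subsingleton := by
  intro h1
  have hq0 : 0 < q := by linarith
  have hq1 : 0 < q - 1 := by linarith
  have hqq : 0 < q ^ 2 - 1 := by nlinarith
  have m0 := (Tmap_mem_of_mem_Sq hq hx 0).2
  have m1 := (Tmap_mem_of_mem_Sq hq hx 1).1
  have h0 := SigmaSet_reflect_subsingleton hq h0
  rw [Tmap_zero] at m0 h0
  rw [Tmap_one] at m1 h1
  have hlt : 1 / (q - 1) - 1 < 1 / q := by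
    rw [sub_lt_iff_lt_add, div_lt_iff₀ hq1]
    field_simp
    linarith
  set y := q * x - 1 with hy
  have hxy : q * x = y + 1 := by rw [hy]; ring
  rw [hxy] at m0 h0
  set z := reflect q (y + 1) with hz
  rw [reflect] at hz
  have hz0 : 0 ≤ z := by linarith
  have hyz : y + z = 1 / (q - 1) - 1 := by linarith
  have e : (1 / (q - 1) - 1) * (q ^ 2 - 1) = 2 + q - q ^ 2 := by field_simp; ring
  have aux : ∀ w : ℝ, 0 ≤ w → w < 1 / q → (SigmaSet q w).Subsingleton →
      w * (q ^ 2 - 1) = 0 ∨ ∃ k : ℕ, w * (q ^ 2 - 1) = (1 / q) ^ k := by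
    intro w hw0 hw1 hw
    rcases hw0.eq_or_lt with rfl | hw0
    · left; ring
    · obtain ⟨k, hk⟩ := exists_of_subsingleton_left hq hq2 hG hf hw0 hw1 hw
      exact Or.inr ⟨k, by rw [hk]; field_simp⟩
  rw [← hyz, add_mul] at e
  rcases aux y m1 (by linarith) h1 with hY | ⟨k, hY⟩ <;>
    rcases aux z hz0 (by linarith) h0 with hZ | ⟨l, hZ⟩ <;> rw [hY, hZ] at e
  · nlinarith
  · exact one_div_pow_ne hq hG hf l (by linarith)
  · exact one_div_pow_ne hq hG hf k (by linarith)
  · rcases le_total k l with h | h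
    · exact hne (pow_add_pow_eq hq hG hf h e)
    · exact hne (pow_add_pow_eq hq hG hf h (by linarith))

lemma ncard_SigmaSet (hq : 1 < q) {x : ℝ} (h : (SigmaSet q x).Finite) :
    (SigmaSet q x).ncard = (SigmaSet q (Tmap q 0 x)).ncard + (SigmaSet q (Tmap q 1 x)).ncard := by
  have hf : ∀ i, (digitCons i '' SigmaSet q (Tmap q i x)).Finite := fun i =>
    h.subset (digitCons_image_subset hq i x)
  rw [SigmaSet_eq_union hq, ncard_union_eq ?_ (hf 0) (hf 1),
    ncard_image_of_injective _ (digitCons_injective 0),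
    ncard_image_of_injective _ (digitCons_injective 1)]
  rw [Set.disjoint_left]
  rintro _ ⟨ε, -, rfl⟩ ⟨δ, -, hδ⟩
  have := congrFun hδ 0
  simp [digitCons] at this

lemma subsingleton_of_finite (hq : 1 < q)
    (hb : ∀ x ∈ Sq q, (SigmaSet q (Tmap q 0 x)).Subsingleton →
      ¬ (SigmaSet q (Tmap q 1 x)).Subsingleton) {x : ℝ}
    (h : (SigmaSet q x).Finite) : (SigmaSet q x).Subsingleton := by
  have hT : ∀ {x : ℝ}, (SigmaSet q x).Finite → ∀ i, (SigmaSet q (Tmap q i x)).Finite :=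
    fun h i => not_infinite.1 fun h' => SigmaSet_infinite_of_Tmap hq h' h
  induction hN : (SigmaSet q x).ncard using Nat.strong_induction_on generalizing x with
  | _ N ihN =>
  suffices H : ∀ n : ℕ, ∀ x : ℝ, (SigmaSet q x).Finite → (SigmaSet q x).ncard ≤ N →
      ∀ ε ∈ SigmaSet q x, ∀ δ ∈ SigmaSet q x, ε n = δ n from
    fun ε hε δ hδ => funext fun n => H n x h hN.le ε hε δ hδ
  have H0 : ∀ x : ℝ, (SigmaSet q x).Finite → (SigmaSet q x).ncard ≤ N →
      ∀ ε ∈ SigmaSet q x, ∀ δ ∈ SigmaSet q x, ε 0 = δ 0 := by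
    intro x h hN ε hε δ hδ
    by_contra hne
    have hne' : ∀ i, (SigmaSet q (Tmap q i x)).Nonempty := by
      intro i
      rcases (by omega : i = ε 0 ∨ i = δ 0) with rfl | rfl
      · exact ⟨_, (mem_SigmaSet_iff_tail hq).1 hε⟩
      · exact ⟨_, (mem_SigmaSet_iff_tail hq).1 hδ⟩
    have hc := ncard_SigmaSet hq h
    have c0 := (ncard_pos (hT h 0)).2 (hne' 0)
    have c1 := (ncard_pos (hT h 1)).2 (hne' 1)
    refine hb x (mem_Sq_of_Tmap_mem hq fun i => ?_) (ihN _ ?_ (hT h 0) rfl)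
      (ihN _ ?_ (hT h 1) rfl)
    · exact (hne' i).elim fun _ hε => mem_Iq_of_mem_SigmaSet hq hε
    · omega
    · omega
  intro n
  induction n with
  | zero => exact H0
  | succ n ih =>
    intro x h hN ε hε δ hδ
    have h1 := (mem_SigmaSet_iff_tail hq).1 hε
    have h2 := (mem_SigmaSet_iff_tail hq).1 hδ
    rw [← H0 x h hN ε hε δ hδ] at h2
    refine ih _ (hT h _) (le_trans ?_ hN) _ h1 _ h2
    rw [← ncard_image_of_injective _ (digitCons_injective (ε 0))]
    exact ncard_le_ncard (digitCons_image_subset hq _ _) h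

end UniqueExpansions

section VisitJq

variable {q : ℝ}

lemma exists_mem_Jq_of_lt (hq : 1 < q) (hq2 : q < 2) (hG : q + 1 < q ^ 2)
    (hf : q ^ 3 < 2 * q ^ 2 - q + 1)
    (hb : ∀ x ∈ Sq q, (SigmaSet q (Tmap q 0 x)).Subsingleton →
      ¬ (SigmaSet q (Tmap q 1 x)).Subsingleton) {x : ℝ} (hx : x ∈ Sq q)
    (hxJ : x < (q + q ^ 2) / (q ^ 4 - 1)) (hi : (SigmaSet q x).Infinite)
    (ht : HereditarilyThin q x) :
    ∃ z ∈ Sq q, z ∈ Jq q ∧ (SigmaSet q z).Infinite ∧ HereditarilyThin q z := by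
  have hq0 : 0 < q := by linarith
  have hq1 : 0 < q - 1 := by linarith
  have hqq : 0 < q ^ 2 - 1 := by nlinarith
  have hq4 : 0 < q ^ 4 - 1 := by nlinarith
  have hc : 1 / (q ^ 2 - 1) < 1 / q := one_div_lt_one_div_of_lt hq0 (by linarith)
  have hd : 0 < x - 1 / (q ^ 2 - 1) := by linarith [hx.1]
  obtain ⟨n, hn⟩ := pow_unbounded_of_one_lt (1 / (x - 1 / (q ^ 2 - 1)))
    (by linarith : 1 < q ^ 2)
  rw [div_lt_iff₀ hd] at hn
  have hJ1 : (q + q ^ 2) / (q ^ 4 - 1) ≤ 1 := by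
    rw [div_le_one hq4]; nlinarith
  have hJ2 : (1 + q ^ 3) / (q ^ 4 - 1) < 1 / (q * (q - 1)) := by
    rw [div_lt_div_iff₀ hq4 (by positivity)]
    nlinarith [mul_pos (mul_pos (by linarith : 0 < 2 * q ^ 2 - q + 1 - q ^ 3)
      (by linarith : 0 < q + 1)) hq1]
  have hqi : 1 / q ≤ q - 1 := by
    rw [div_le_iff₀ hq0]; nlinarith
  induction n generalizing x with
  | zero =>
    have h0 : 0 < 1 / (q ^ 2 - 1) := by positivity
    rw [pow_zero, one_mul] at hn
    linarith
  | succ n ih =>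
    have hw : Tmap q 1 (Tmap q 0 x) = q * (q * x) - 1 := by rw [Tmap_zero, Tmap_one]
    have hqx : 1 ≤ q * x := by
      have := hx.1
      rw [div_le_iff₀ hq0] at this; linarith
    have hwr : q * (q * x) - 1 < (1 + q ^ 3) / (q ^ 4 - 1) := by
      rw [lt_div_iff₀ hq4] at hxJ ⊢
      nlinarith [mul_lt_mul_of_pos_left hxJ (by positivity : 0 < q ^ 2)]
    have hwS : Tmap q 1 (Tmap q 0 x) ∈ Sq q := by
      rw [hw]; exact ⟨by nlinarith, by linarith⟩
    have hi0 : (SigmaSet q (Tmap q 0 x)).Infinite := by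
      intro hfin
      exact not_mem_Sq_of_subsingleton hq hq2
        (SigmaSet_subsingleton_Tmap hq (subsingleton_of_finite hq hb hfin) 1) hwS
    have hi1 : (SigmaSet q (Tmap q 1 (Tmap q 0 x))).Infinite := by
      obtain ⟨i, hi⟩ := exists_Tmap_infinite hq _ hi0
      rcases Fin.exists_fin_two.1 ⟨i, rfl⟩ with rfl | rfl
      · obtain ⟨ε, hε⟩ := hi.nonempty
        have := ((Tmap_zero_mem_Iq_iff hq).1 (mem_Iq_of_mem_SigmaSet hq hε)).2
        rw [Tmap_zero, le_div_iff₀ (by positivity)] at this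
        nlinarith
      · exact hi
    have htw := (ht.Tmap 0).Tmap 1
    by_cases hwJ : q * (q * x) - 1 < (q + q ^ 2) / (q ^ 4 - 1)
    · have he : q * (q * x) - 1 - 1 / (q ^ 2 - 1) = q ^ 2 * (x - 1 / (q ^ 2 - 1)) := by
        field_simp; ring
      rw [hw] at hwS hi1 htw
      refine ih hwS hwJ hi1 htw (by rw [he]; positivity) ?_
      rw [he, ← mul_assoc, ← pow_succ]
      exact hn
    · exact ⟨_, hwS, by rw [hw]; exact ⟨not_lt.1 hwJ, hwr.le⟩, hi1, htw⟩

lemma exists_mem_Jq (hq : 1 < q) (hq2 : q < 2) (hG : q + 1 < q ^ 2)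
    (hf : q ^ 3 < 2 * q ^ 2 - q + 1)
    (hb : ∀ x ∈ Sq q, (SigmaSet q (Tmap q 0 x)).Subsingleton →
      ¬ (SigmaSet q (Tmap q 1 x)).Subsingleton) {x : ℝ} (hx : x ∈ Sq q)
    (hi : (SigmaSet q x).Infinite) (ht : HereditarilyThin q x) :
    ∃ z ∈ Sq q, z ∈ Jq q ∧ (SigmaSet q z).Infinite ∧ HereditarilyThin q z := by
  by_cases hJ : x ∈ Jq q
  · exact ⟨x, hx, hJ, hi, ht⟩
  by_cases h : x < (q + q ^ 2) / (q ^ 4 - 1)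
  · exact exists_mem_Jq_of_lt hq hq2 hG hf hb hx h hi ht
  by_cases h' : reflect q x < (q + q ^ 2) / (q ^ 4 - 1)
  · obtain ⟨z, h1, h2, h3, h4⟩ := exists_mem_Jq_of_lt hq hq2 hG hf hb ((reflect_mem_Sq hq).2 hx) h'
      (fun hfin => hi ((SigmaSet_reflect_finite hq).1 hfin)) (ht.reflect hq)
    exact ⟨reflect q z, (reflect_mem_Sq hq).2 h1, (reflect_mem_Jq hq).2 h2,
      fun hfin => h3 ((SigmaSet_reflect_finite hq).1 hfin), h4.reflect hq⟩
  · refine absurd ⟨not_lt.1 h, ?_⟩ hJ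
    have hq1 : q - 1 ≠ 0 := by linarith
    have hq4 : q ^ 4 - 1 ≠ 0 := by
      have := one_lt_pow₀ hq (n := 4) (by norm_num)
      linarith
    have he : 1 / (q - 1) - (q + q ^ 2) / (q ^ 4 - 1) = (1 + q ^ 3) / (q ^ 4 - 1) := by
      field_simp; ring
    rw [← he]
    have := not_lt.1 h'
    rw [reflect] at this
    linarith

end VisitJq

/-- For `q ∈ [q_{ℵ₀}, q_f)` with `q ≠ q_2`, `q ∈ B_{ℵ₀}` iff
`P_q = (T_{q,0}⁻¹(U_q) ∩ J_q) ∪ (T_{q,1}⁻¹(U_q) ∩ J_q)` contains a `q` null infinite point. -/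
theorem BAleph0_iff_Pq_null_infinite
    (qA : ℝ) (hqA1 : qA ∈ Set.Ioo (1 : ℝ) 2)
    (hqA2 : qA ^ 6 = qA ^ 4 + qA ^ 3 + 2 * qA ^ 2 + qA + 1)
    (qf : ℝ) (hqf1 : qf ∈ Set.Ioo (1 : ℝ) 2) (hqf2 : qf ^ 3 = 2 * qf ^ 2 - qf + 1)
    (q2 : ℝ) (hq21 : q2 ∈ Set.Ioo (1 : ℝ) 2) (hq22 : q2 ^ 4 = 2 * q2 ^ 2 + q2 + 1)
    (q : ℝ) (hq : q ∈ Set.Ico qA qf) (hqne : q ≠ q2) :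
    q ∈ BAleph0 ↔
      ∃ x ∈ (Tmap q 0 ⁻¹' UniqSet q ∩ Jq q) ∪ (Tmap q 1 ⁻¹' UniqSet q ∩ Jq q),
        NullInfinite q x := by
  have hA1 := hqA1.1
  have hq1 : 1 < q := by linarith [hq.1]
  have hqf : q < qf := hq.2
  have hq2 : q < 2 := by linarith [hqf1.2]
  have hGA : qA + 1 < qA ^ 2 := by
    have h : (qA ^ 2 - qA - 1) * (qA ^ 4 + qA ^ 3 + qA ^ 2 + qA) = 1 := by
      linear_combination hqA2
    have := pos_of_mul_pos_left (h ▸ one_pos) (by positivity)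
    linarith
  have hG : q + 1 < q ^ 2 := by nlinarith [hq.1]
  have hf : q ^ 3 < 2 * q ^ 2 - q + 1 := by
    have h : 0 < qf ^ 2 + qf * q + q ^ 2 - 2 * (qf + q) + 1 := by
      nlinarith [mul_pos (sub_pos.2 hq1) (sub_pos.2 hqf1.1)]
    nlinarith [mul_pos (sub_pos.2 hqf) h]
  have hne : q ^ 4 ≠ 2 * q ^ 2 + q + 1 := by
    intro h
    have h0 : (q - q2) * (q ^ 3 + q ^ 2 * q2 + q * q2 ^ 2 + q2 ^ 3 - 2 * q - 2 * q2 - 1) = 0 := by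
      linear_combination h - hq22
    rcases mul_eq_zero.1 h0 with h | h
    · exact hqne (sub_eq_zero.1 h)
    · have h1 : 0 < q2 := by linarith [hq21.1]
      have : 2 * q + 1 < q ^ 3 := by nlinarith
      have : 2 * q2 < q ^ 2 * q2 := by nlinarith
      have : 0 < q * q2 ^ 2 + q2 ^ 3 := by positivity
      linarith
  have hb := fun x (hx : x ∈ Sq q) => not_both_subsingleton hq1 hq2 hG hf hne hx
  constructor
  · rintro ⟨-, x, -, hx⟩
    have hc : (SigmaSet q x).Countable := Cardinal.le_aleph0_iff_set_countable.1 hx.le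
    have hi : (SigmaSet q x).Infinite := by
      rw [← Set.infinite_coe_iff, Cardinal.infinite_iff, hx]
    obtain ⟨y, hyi, hyt⟩ := exists_hereditarilyThin hq1 hc hi
    obtain ⟨w, hwS, hwi, hwt⟩ := exists_mem_Sq hq1 hyi hyt
    obtain ⟨z, hzS, hzJ, hzi, hzt⟩ := exists_mem_Jq hq1 hq2 hG hf hb hwS hwi hwt
    refine ⟨z, ?_, (nullInfinite_iff hq1).2 ⟨hzi, hzt⟩⟩
    obtain ⟨i, hfin⟩ := hzt []
    have hU : Tmap q i z ∈ UniqSet q := (UniqSet_iff hq1 hq2).2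
      ⟨Tmap_mem_of_mem_Sq hq1 hzS i, subsingleton_of_finite hq1 hb hfin⟩
    rcases Fin.exists_fin_two.1 ⟨i, rfl⟩ with rfl | rfl
    · exact Or.inl ⟨hU, hzJ⟩
    · exact Or.inr ⟨hU, hzJ⟩
  · rintro ⟨x, -, hx⟩
    obtain ⟨hi, ht⟩ := (nullInfinite_iff hq1).1 hx
    refine ⟨⟨hq1, hq2⟩, x, hx.1, ?_⟩
    have := (ht.countable hq1).to_subtype
    have := hi.to_subtype
    exact Cardinal.mk_eq_aleph0 _
end
end

section
/- For each integer k ≥ 3 let α_k be the unique q ∈ (1,2) satisfying T_{q,0}((1+q³)/(q⁴−1)) = ((1)^k (10)^∞)_q, equivalently the appropriate root of x^{k+4} = x^{k+3} + x^{k+2} + x^k − x² − 1. Then α_3 = q_{ℵ₀}, α_k ∈ [q_{ℵ₀}, q_f) for all k ≥ 3, the sequence (α_k) is strictly increasing, and α_k → q_f as k → ∞. -/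
noncomputable section

open Set

/-- The tail digits `(10)^∞`, placed after `k` digits, contribute `q / (q ^ k * (q ^ 2 - 1))`. -/
lemma hasSum_one_zero_periodic {q : ℝ} (hq : 1 < q) (k : ℕ) :
    HasSum (fun j : ℕ => (((([1, 0] : List (Fin 2)).getD (j % 2) 0 : Fin 2) : ℕ) : ℝ) /
      q ^ (j + k + 1)) (q / (q ^ k * (q ^ 2 - 1))) := by
  have hq0 : 0 < q := by linarith
  have hsq : 1 < q ^ 2 := by nlinarith
  rw [← add_zero (q / _)]
  apply HasSum.even_add_odd
  · have hgeom := (hasSum_geometric_of_lt_one (r := (q ^ 2)⁻¹) (by positivity)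
      (inv_lt_one_of_one_lt₀ hsq)).mul_left (1 / q ^ (k + 1))
    have hval : 1 / q ^ (k + 1) * (1 - (q ^ 2)⁻¹)⁻¹ = q / (q ^ k * (q ^ 2 - 1)) := by
      have : q ^ 2 - 1 ≠ 0 := by linarith
      have h' : 1 - (q ^ 2)⁻¹ = (q ^ 2 - 1) / q ^ 2 := by field_simp
      rw [h', pow_succ]
      field_simp
    rw [hval] at hgeom
    refine (congrArg (HasSum · _) (funext fun j => ?_)).mpr hgeom
    simp only [Nat.mul_mod_right, List.getD_cons_zero, Fin.val_one, Nat.cast_one, inv_pow]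
    rw [show 2 * j + k + 1 = 2 * j + (k + 1) by ring, pow_add, pow_mul]
    field_simp
  · convert (hasSum_zero : HasSum (fun _ : ℕ => (0 : ℝ)) 0) using 2 with j
    have : (2 * j + 1) % 2 = 1 := by omega
    simp [this]

lemma seqVal_ones_periodic {q : ℝ} (hq : 1 < q) (k : ℕ) :
    seqVal q (uwInf (List.replicate k 1) [1, 0]) =
      ((q + 1) * (q ^ k - 1) + q) / (q ^ k * (q ^ 2 - 1)) := by
  have hq0 : 0 < q := by linarith
  have hq1 : q - 1 ≠ 0 := by linarith
  have hsq : q ^ 2 - 1 ≠ 0 := by nlinarith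
  have hhead : ∀ m : ℕ, ∑ i ∈ Finset.range m, 1 / q ^ (i + 1) =
      (q + 1) * (q ^ m - 1) / (q ^ m * (q ^ 2 - 1)) := by
    intro m
    induction m with
    | zero => simp
    | succ m ih =>
      rw [Finset.sum_range_succ, ih, pow_succ]
      field_simp
      ring
  have hdigits : ∑ i ∈ Finset.range k,
      ((uwInf (List.replicate k 1) [1, 0] i : ℕ) : ℝ) / q ^ (i + 1) =
        (q + 1) * (q ^ k - 1) / (q ^ k * (q ^ 2 - 1)) := by
    rw [← hhead]
    refine Finset.sum_congr rfl fun i hi => ?_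
    have : i < k := Finset.mem_range.1 hi
    simp [uwInf, this]
  have htail : HasSum (fun j : ℕ =>
      ((uwInf (List.replicate k 1) [1, 0] (j + k) : ℕ) : ℝ) / q ^ (j + k + 1))
      (q / (q ^ k * (q ^ 2 - 1))) := by
    simpa [uwInf] using hasSum_one_zero_periodic hq k
  have hsum := (hasSum_nat_add_iff (f := fun i : ℕ =>
    ((uwInf (List.replicate k 1) [1, 0] i : ℕ) : ℝ) / q ^ (i + 1)) k).1 htail
  rw [seqVal, hsum.tsum_eq, hdigits]
  ring

/-- The partial sums `∑_{j<k} (x² + 1) / x^(j+4)`; they equal `1` exactly at the roots `≠ 1` of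
`x^(k+4) = x^(k+3) + x^(k+2) + x^k - x² - 1`. -/
def alphaSum (k : ℕ) (x : ℝ) : ℝ := ∑ j ∈ Finset.range k, (x ^ 2 + 1) / x ^ (j + 4)

lemma alphaSum_succ (k : ℕ) (x : ℝ) :
    alphaSum (k + 1) x = alphaSum k x + (x ^ 2 + 1) / x ^ (k + 4) :=
  Finset.sum_range_succ _ _

lemma sub_one_mul_one_sub_alphaSum {x : ℝ} (hx : 0 < x) (k : ℕ) :
    x ^ (k + 3) * (x - 1) * (1 - alphaSum k x) =
      x ^ (k + 4) - (x ^ (k + 3) + x ^ (k + 2) + x ^ k - x ^ 2 - 1) := by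
  induction k with
  | zero => simp [alphaSum]; ring
  | succ k ih =>
    have h : x ^ (k + 4) * ((x ^ 2 + 1) / x ^ (k + 4)) = x ^ 2 + 1 := by field_simp
    rw [alphaSum_succ]
    linear_combination x * ih - (x - 1) * h

lemma alphaSum_eq_one_iff {x : ℝ} (hx : 1 < x) (k : ℕ) :
    alphaSum k x = 1 ↔ x ^ (k + 4) = x ^ (k + 3) + x ^ (k + 2) + x ^ k - x ^ 2 - 1 := by
  have hx0 : 0 < x := by linarith
  have hne : x ^ (k + 3) * (x - 1) ≠ 0 := mul_ne_zero (by positivity) (by linarith)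
  rw [← sub_eq_zero (a := x ^ (k + 4)), ← sub_one_mul_one_sub_alphaSum hx0, mul_eq_zero,
    or_iff_right hne, sub_eq_zero, eq_comm]

lemma alphaSum_strictAntiOn {k : ℕ} (hk : k ≠ 0) : StrictAntiOn (alphaSum k) (Ioi 0) := by
  intro x hx y hy hxy
  have hx : 0 < x := hx
  have hy : 0 < y := hy
  refine Finset.sum_lt_sum_of_nonempty (by simpa using hk) fun j _ => ?_
  have h : ∀ z : ℝ, 0 < z → (z ^ 2 + 1) / z ^ (j + 4) = 1 / z ^ (j + 2) + 1 / z ^ (j + 4) := by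
    intro z hz
    field_simp
    ring
  rw [h x hx, h y hy]
  gcongr

lemma alphaSum_lt_succ {x : ℝ} (hx : 0 < x) (k : ℕ) : alphaSum k x < alphaSum (k + 1) x := by
  rw [alphaSum_succ]
  have : 0 < (x ^ 2 + 1) / x ^ (k + 4) := by positivity
  linarith

lemma alphaSum_lt_one_of_cubic {x : ℝ} (hx : 1 < x) (h : x ^ 3 = 2 * x ^ 2 - x + 1) (k : ℕ) :
    alphaSum k x < 1 := by
  have hx0 : 0 < x := by linarith
  have hpos : 0 < x ^ (k + 3) * (x - 1) := mul_pos (by positivity) (by linarith)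
  have hval : x ^ (k + 3) * (x - 1) * (1 - alphaSum k x) = x ^ 2 + 1 := by
    rw [sub_one_mul_one_sub_alphaSum hx0]
    linear_combination x ^ k * (x + 1) * h
  have : 0 < 1 - alphaSum k x := pos_of_mul_pos_right (hval ▸ by positivity) hpos.le
  linarith

/-- A root `a` of the degree `k + 4` equation is within `O(a^(-k))` of the root `x` of the cubic. -/
lemma mul_sub_le_of_cubic {x a : ℝ} (h : x ^ 3 = 2 * x ^ 2 - x + 1)
    (ha : a ∈ Ioo (1 : ℝ) 2) (hax : a < x) {k : ℕ}
    (hroot : a ^ (k + 4) = a ^ (k + 3) + a ^ (k + 2) + a ^ k - a ^ 2 - 1) :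
    (x - 1) * (x - a) ≤ 5 / a ^ k := by
  obtain ⟨ha1, ha2⟩ := ha
  have hak : 0 < a ^ k := by positivity
  have hcubic : (x - 1) * (x - a) ≤ -(a ^ 3 - 2 * a ^ 2 + a - 1) := by
    have hfac : -(a ^ 3 - 2 * a ^ 2 + a - 1) = (x - a) * ((x - 1) ^ 2 + (x - 1) * (a - 1) +
        (a - 1) ^ 2 + (x - 1) + (a - 1)) := by linear_combination -h
    have h1 : 0 ≤ (x - 1) * (a - 1) := mul_nonneg (by linarith) (by linarith)
    rw [hfac, mul_comm]
    exact mul_le_mul_of_nonneg_left (by nlinarith) (by linarith)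
  have hval : a ^ k * ((a + 1) * -(a ^ 3 - 2 * a ^ 2 + a - 1)) = a ^ 2 + 1 := by
    linear_combination -hroot
  have hnn : 0 ≤ (x - 1) * (x - a) := mul_nonneg (by linarith) (by linarith)
  rw [le_div_iff₀ hak]
  have h2 : a ^ k * ((x - 1) * (x - a)) ≤
      a ^ k * ((a + 1) * -(a ^ 3 - 2 * a ^ 2 + a - 1)) := by
    refine mul_le_mul_of_nonneg_left ?_ hak.le
    nlinarith
  nlinarith

/-- Properties of the sequence `α_k` (`k ≥ 3`), where `α_k` is the unique
`q ∈ (1,2)` with `q^{k+4} = q^{k+3} + q^{k+2} + q^k − q² − 1`: it satisfies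
`T_{q,0}((1+q³)/(q⁴−1)) = ((1)^k(10)^∞)_q` at `q = α_k`; moreover `α_3 = q_{ℵ₀}`,
`α_k ∈ [q_{ℵ₀}, q_f)`, `(α_k)` is strictly increasing, and `α_k → q_f`. -/
theorem alpha_k_properties
    (qA : ℝ) (hqA1 : qA ∈ Set.Ioo (1 : ℝ) 2)
    (hqA2 : qA ^ 6 = qA ^ 4 + qA ^ 3 + 2 * qA ^ 2 + qA + 1)
    (qf : ℝ) (hqf1 : qf ∈ Set.Ioo (1 : ℝ) 2) (hqf2 : qf ^ 3 = 2 * qf ^ 2 - qf + 1)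
    (α : ℕ → ℝ)
    (hα : ∀ k, 3 ≤ k → α k ∈ Set.Ioo (1 : ℝ) 2 ∧
      (α k) ^ (k + 4) = (α k) ^ (k + 3) + (α k) ^ (k + 2) + (α k) ^ k - (α k) ^ 2 - 1) :
    (∀ k, 3 ≤ k → Tmap (α k) 0 ((1 + (α k) ^ 3) / ((α k) ^ 4 - 1)) =
      seqVal (α k) (uwInf (List.replicate k 1) [1, 0])) ∧
    α 3 = qA ∧
    (∀ k, 3 ≤ k → α k ∈ Set.Ico qA qf) ∧
    (∀ k, 3 ≤ k → α k < α (k + 1)) ∧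
    Filter.Tendsto (fun k => α k) Filter.atTop (nhds qf) := by
  have hA1 := hqA1.1
  have hf1 := hqf1.1
  have hpos : ∀ k, 3 ≤ k → α k ∈ Ioi (0 : ℝ) := fun k hk => zero_lt_one.trans (hα k hk).1.1
  have hsum : ∀ k, 3 ≤ k → alphaSum k (α k) = 1 := fun k hk =>
    (alphaSum_eq_one_iff (hα k hk).1.1 k).2 (hα k hk).2
  have hthree : α 3 = qA := by
    refine (alphaSum_strictAntiOn three_ne_zero).injOn (hpos 3 le_rfl)
      (zero_lt_one.trans hA1) ?_
    rw [hsum 3 le_rfl, eq_comm, alphaSum_eq_one_iff hA1]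
    linear_combination (qA - 1) * hqA2
  have hlt : ∀ k, 3 ≤ k → α k < α (k + 1) := by
    intro k hk
    refine ((alphaSum_strictAntiOn k.succ_ne_zero).lt_iff_gt
      (hpos (k + 1) (by omega)) (hpos k hk)).1 ?_
    rw [hsum (k + 1) (by omega), ← hsum k hk]
    exact alphaSum_lt_succ (hpos k hk) k
  have hlower : ∀ k, 3 ≤ k → qA ≤ α k := by
    intro k hk
    induction k, hk using Nat.le_induction with
    | base => exact hthree.ge
    | succ k hk ih => exact ih.trans (hlt k hk).le
  have hupper : ∀ k, 3 ≤ k → α k < qf := by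
    intro k hk
    refine ((alphaSum_strictAntiOn (k := k) (by omega)).lt_iff_gt
      (zero_lt_one.trans hf1) (hpos k hk)).1 ?_
    rw [hsum k hk]
    exact alphaSum_lt_one_of_cubic hf1 hqf2 k
  refine ⟨fun k hk => ?_, hthree, fun k hk => ⟨hlower k hk, hupper k hk⟩, hlt, ?_⟩
  · obtain ⟨⟨h1, -⟩, hroot⟩ := hα k hk
    generalize α k = q at h1 hroot
    have hq0 : 0 < q := by linarith
    have hsq : q ^ 2 - 1 ≠ 0 := by nlinarith
    have hfour : q ^ 4 - 1 ≠ 0 := by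
      rw [show q ^ 4 - 1 = (q ^ 2 - 1) * (q ^ 2 + 1) by ring]
      exact mul_ne_zero hsq (by positivity)
    rw [seqVal_ones_periodic h1, Tmap, Fin.val_zero, Nat.cast_zero, sub_zero, ← mul_div_assoc,
      div_eq_div_iff hfour (by positivity)]
    linear_combination (q ^ 2 - 1) * hroot
  · have hbound : Filter.Tendsto (fun k : ℕ => qf - 5 / (qf - 1) * qA⁻¹ ^ k)
        Filter.atTop (nhds qf) := by
      simpa using ((tendsto_pow_atTop_nhds_zero_of_lt_one (by positivity)
        (inv_lt_one_of_one_lt₀ hA1)).const_mul (5 / (qf - 1))).const_sub qf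
    refine tendsto_of_tendsto_of_tendsto_of_le_of_le' hbound tendsto_const_nhds ?_ ?_
    · filter_upwards [Filter.eventually_ge_atTop 3] with k hk
      have h1 := mul_sub_le_of_cubic hqf2 (hα k hk).1 (hupper k hk) (hα k hk).2
      have h2 : 5 / α k ^ k ≤ 5 / qA ^ k := by
        have := hlower k hk
        gcongr
      have h3 : qf - α k ≤ 5 / qA ^ k / (qf - 1) := by
        rw [le_div_iff₀ (by linarith), mul_comm]
        exact h1.trans h2
      have h4 : 5 / qA ^ k / (qf - 1) = 5 / (qf - 1) * qA⁻¹ ^ k := by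
        rw [inv_pow]
        ring
      linarith
    · filter_upwards [Filter.eventually_ge_atTop 3] with k hk
      exact (hupper k hk).le
end
end
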